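/- Let Λ be a family of n pseudoplanes in general position in ℝ³ and let k be a nonnegative integer. Then the number X^k of ordered pairs of immersed k-corridors in the arrangement of Λ satisfies X^k ≥ |C^k|³/(64 n⁴) − n². -/

import Mathlib

open scoped Classical

noncomputable section

/-- A pseudoplane, identified with the total bivariate (curried) function whose graph it is. -/
abbrev PP : Type := ℝ → ℝ → ℝ

/-- `φ : ℝ → ℝ` is the continuous function whose graph is the xy-projection of the
intersection curve `γ_{a,b} = a ∩ b` of the pseudoplanes `a` and `b`. -/
def IsGraphFun (a b : PP) (φ : ℝ → ℝ) : Prop :=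
  Continuous φ ∧ ∀ x y : ℝ, a x y = b x y ↔ y = φ x

/-- A family of pseudoplanes in general position in ℝ³:
(1) each member is (the graph of) a continuous total bivariate function;
(2) the intersection of any two distinct members is the graph of a continuous
    function `φ_{a,b} : ℝ → ℝ` (a connected x-monotone unbounded curve);
(3) any three distinct members intersect in exactly one point;
(4) the xy-projections of the intersection curves form a family of pseudolines:
    for distinct pairs `{a,b} ≠ {c,d}`, `φ_{a,b}` and `φ_{c,d}` agree at exactly one point;
(5) no point is incident to more than three pseudoplanes;
(6) no two pseudoplanes are tangent (the difference changes sign);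
(7) no intersection curve of two pseudoplanes is tangent to a third pseudoplane
    (the relevant difference function takes both signs). -/
def PseudoplaneFamily (Λ : Finset PP) : Prop :=
  (∀ a ∈ Λ, Continuous fun q : ℝ × ℝ => a q.1 q.2) ∧
  (∀ a ∈ Λ, ∀ b ∈ Λ, a ≠ b → ∃ φ : ℝ → ℝ, IsGraphFun a b φ) ∧
  (∀ a ∈ Λ, ∀ b ∈ Λ, ∀ c ∈ Λ, a ≠ b → a ≠ c → b ≠ c →
    ∃! q : ℝ × ℝ, a q.1 q.2 = b q.1 q.2 ∧ a q.1 q.2 = c q.1 q.2) ∧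
  (∀ a ∈ Λ, ∀ b ∈ Λ, ∀ c ∈ Λ, ∀ d ∈ Λ, a ≠ b → c ≠ d → ({a, b} : Finset PP) ≠ {c, d} →
    ∀ φ ψ : ℝ → ℝ, IsGraphFun a b φ → IsGraphFun c d ψ → ∃! x : ℝ, φ x = ψ x) ∧
  (∀ a ∈ Λ, ∀ b ∈ Λ, ∀ c ∈ Λ, ∀ d ∈ Λ, a ≠ b → a ≠ c → a ≠ d → b ≠ c → b ≠ d → c ≠ d →
    ¬ ∃ x y : ℝ, a x y = b x y ∧ a x y = c x y ∧ a x y = d x y) ∧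
  (∀ a ∈ Λ, ∀ b ∈ Λ, a ≠ b → (∃ x y : ℝ, a x y < b x y) ∧ (∃ x y : ℝ, b x y < a x y)) ∧
  (∀ a ∈ Λ, ∀ b ∈ Λ, ∀ c ∈ Λ, a ≠ b → a ≠ c → b ≠ c → ∀ φ : ℝ → ℝ, IsGraphFun a b φ →
    (∃ x : ℝ, c x (φ x) < a x (φ x)) ∧ (∃ x : ℝ, a x (φ x) < c x (φ x)))

/-- The level of the point `(x, y, z)`: the number of members of `Λ` passing strictly below it. -/
def level (Λ : Finset PP) (x y z : ℝ) : ℕ :=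
  (Λ.filter fun a => a x y < z).card

/-- The triple `s = {a,b,c}` spans a `k`-corridor: its common (triple intersection) point
is at level `k`. -/
def IsKCorridorTriple (Λ : Finset PP) (k : ℕ) (s : Finset PP) : Prop :=
  ∃ x y z : ℝ, (∀ a ∈ s, a x y = z) ∧ level Λ x y z = k

/-- The set `C^k` of `k`-corridors, encoded by the 3-element subsets of `Λ` spanning them. -/
def kCorridors (Λ : Finset PP) (k : ℕ) : Finset (Finset PP) :=
  (Λ.powersetCard 3).filter (IsKCorridorTriple Λ k)

/-- The corridor of a triple `s`: the open region strictly between the lower and the upper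
envelope of the three surfaces in `s`. Points of ℝ³ are `(x, (y, z))`. -/
def corridorSet (s : Finset PP) : Set (ℝ × ℝ × ℝ) :=
  {p | (∃ a ∈ s, a p.1 p.2.1 < p.2.2) ∧ (∃ a ∈ s, p.2.2 < a p.1 p.2.1)}

/-- The common intersection curve of the members of `s`. -/
def curveSet (s : Finset PP) : Set (ℝ × ℝ × ℝ) :=
  {p | ∀ a ∈ s, a p.1 p.2.1 = p.2.2}

/-- The corridor spanned by `s₁` is immersed in the corridor spanned by `s₂`: they share
exactly one pseudoplane, and the intersection curve of the other two pseudoplanes of `s₁`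
is fully contained in the corridor of `s₂`. -/
def Immersed (s₁ s₂ : Finset PP) : Prop :=
  (s₁ ∩ s₂).card = 1 ∧ curveSet (s₁ \ s₂) ⊆ corridorSet s₂

/-- `X^k`: the number of ordered pairs of `k`-corridors such that the first is immersed
in the second. -/
def numImmersedPairs (Λ : Finset PP) (k : ℕ) : ℕ :=
  ((kCorridors Λ k ×ˢ kCorridors Λ k).filter fun q => Immersed q.1 q.2).card


/-- Abstract rank-3 sign system with a distinguished pole. -/
structure Chiro {ι : Type} (R : ι → ι → Prop) (L : ι → ι → ι → Prop) : Prop where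
  hR : ∀ a b, a ≠ b → (R a b ↔ ¬ R b a)
  hR0 : ∀ a, ¬ R a a
  hL1 : ∀ a b c, a ≠ b → a ≠ c → b ≠ c → (L a b c ↔ ¬ L b a c)
  hL2 : ∀ a b c, a ≠ b → a ≠ c → b ≠ c → (L a b c ↔ ¬ L a c b)
  hG3 : ∀ a w x y, a ≠ w → a ≠ x → a ≠ y → w ≠ x → w ≠ y → x ≠ y →
    ¬ ((L a w x ↔ R a y) ∧ ¬ (L a w y ↔ R a x) ∧ (R a w ↔ L a x y)) ∧
    ¬ (¬ (L a w x ↔ R a y) ∧ (L a w y ↔ R a x) ∧ ¬ (R a w ↔ L a x y))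
  hGN : ∀ w x y z, w ≠ x → w ≠ y → w ≠ z → x ≠ y → x ≠ z → y ≠ z →
    ¬ ((R w x ↔ R y z) ∧ ¬ (R w y ↔ R x z) ∧ (R w z ↔ R x y)) ∧
    ¬ (¬ (R w x ↔ R y z) ∧ (R w y ↔ R x z) ∧ ¬ (R w z ↔ R x y))

/-- The abstract crossing relation of the edges `ab` and `cd`. -/
def Crs {ι : Type} (L : ι → ι → ι → Prop) (a b c d : ι) : Prop :=
  (L a b d ↔ ¬ L a b c) ∧ (L a c d ↔ ¬ L a b c) ∧ (L b c d ↔ L a b c)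

section
variable {ι : Type} {R : ι → ι → Prop} {L : ι → ι → ι → Prop}

theorem Chiro.rot (h : Chiro R L) (a b c : ι) (h1 : a ≠ b) (h2 : a ≠ c) (h3 : b ≠ c) :
    (L b c a ↔ L a b c) ∧ (L c a b ↔ L a b c) ∧ (L b a c ↔ ¬ L a b c) ∧
    (L a c b ↔ ¬ L a b c) ∧ (L c b a ↔ ¬ L a b c) := by
  have e1 := h.hL1 a b c h1 h2 h3
  have e2 := h.hL2 a b c h1 h2 h3
  have e3 := h.hL2 b a c h1.symm h3 h2
  have e4 := h.hL1 a c b h2 h1 h3.symm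
  have e5 := h.hL1 b c a h3 h1.symm h2.symm
  tauto

theorem Chiro.ne (h : Chiro R L) {a b : ι} (hab : R a b) : a ≠ b := by
  rintro rfl; exact h.hR0 _ hab

theorem Chiro.asymm (h : Chiro R L) {a b : ι} (hab : R a b) : ¬ R b a :=
  (h.hR a b (h.ne hab)).1 hab

theorem Chiro.T1 (h : Chiro R L) {a e c d : ι} (hae : a ≠ e) (ad : R a d) (ed : R e d)
    (ac : R a c) (dc : R d c) (adc : L a d c) (ade : L a d e) (hn : ¬ (R a e ∧ L a e c)) :
    Crs L e d a c := by
  have n1 := h.ne ad; have n2 := h.ne ed; have n3 := h.ne ac; have n4 := h.ne dc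
  have n5 : e ≠ c := by rintro rfl; exact h.asymm ed dc
  have g1 := h.hG3 e a c d hae.symm n5 n2 n3 n1 n4.symm
  have g2 := h.hG3 c a e d n3.symm n5.symm n4.symm hae n1 n2
  have g3 := h.hG3 d a e c n1.symm n2.symm n4 hae n3 n5
  have r1 := h.rot a e c hae n3 n5
  have r2 := h.rot a e d hae n1 n2
  have r3 := h.rot a c d n3 n1 n4.symm
  have r4 := h.rot e c d n5 n2 n4.symm
  have q1 := h.hR a d n1
  have q2 := h.hR a e hae
  have q3 := h.hR a c n3
  have q4 := h.hR e d n2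
  have q5 := h.hR e c n5
  have q6 := h.hR d c n4
  unfold Crs
  grind

theorem Chiro.T2 (h : Chiro R L) {a e b d : ι} (hae : a ≠ e) (ad : R a d) (ed : R e d)
    (ab : R a b) (db : R d b) (abd : L a b d) (aed : L a e d) (hn : ¬ (R a e ∧ L a b e)) :
    Crs L e d a b := by
  have n1 := h.ne ad; have n2 := h.ne ed; have n3 := h.ne ab; have n4 := h.ne db
  have n5 : e ≠ b := by rintro rfl; exact h.asymm ed db
  have g1 := h.hG3 e a b d hae.symm n5 n2 n3 n1 n4.symm
  have g2 := h.hG3 b a e d n3.symm n5.symm n4.symm hae n1 n2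
  have g3 := h.hG3 d a e b n1.symm n2.symm n4 hae n3 n5
  have r1 := h.rot a e b hae n3 n5
  have r2 := h.rot a e d hae n1 n2
  have r3 := h.rot a b d n3 n1 n4.symm
  have r4 := h.rot e b d n5 n2 n4.symm
  have q1 := h.hR a d n1
  have q2 := h.hR a e hae
  have q3 := h.hR a b n3
  have q4 := h.hR e d n2
  have q5 := h.hR e b n5
  have q6 := h.hR d b n4
  unfold Crs
  grind

theorem Chiro.T3 (h : Chiro R L) {a e b c d : ι} (ae : R a e) (ad : R a d) (ed : R e d)
    (ab : R a b) (db : R d b) (ec : R e c) (dc : R d c)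
    (H : (L a b d ∧ L e d c ∧ L a e b) ∨ (L a d b ∧ L e c d ∧ L a b e)) :
    b ≠ c ∧ Crs L a b e c := by
  have n1 := h.ne ad; have n2 := h.ne ed; have n3 := h.ne ab; have n4 := h.ne db
  have n6 := h.ne ec; have n7 := h.ne dc; have hae := h.ne ae
  have n5 : e ≠ b := by rintro rfl; exact h.asymm ed db
  have n8 : a ≠ c := by rintro rfl; exact h.asymm ad dc
  have r1 := h.rot a e b hae n3 n5
  have r2 := h.rot a e d hae n1 n2
  have r3 := h.rot a b d n3 n1 n4.symm
  have r4 := h.rot e b d n5 n2 n4.symm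
  have q1 := h.hR a d n1
  have q2 := h.hR a e hae
  have q3 := h.hR a b n3
  have q4 := h.hR e d n2
  have q5 := h.hR e b n5
  have q6 := h.hR d b n4
  have g2 := h.hG3 b a e d n3.symm n5.symm n4.symm hae n1 n2
  have hbc : b ≠ c := by
    rintro rfl
    grind
  refine ⟨hbc, ?_⟩
  have g1 := h.hG3 e a b d hae.symm n5 n2 n3 n1 n4.symm
  have g3 := h.hG3 e a c d hae.symm n6 n2 n8 n1 n7.symm
  have g4 := h.hG3 b a e c n3.symm n5.symm hbc hae n8 n6
  have g5 := h.hG3 b a c d n3.symm hbc n4.symm n8 n1 n7.symm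
  have g6 := h.hG3 c e b d n6.symm hbc.symm n7.symm n5 n2 n4.symm
  have g7 := h.hG3 d e b c n2.symm n4 n7 n5 n6 hbc
  have g8 := h.hGN a e b d hae n3 n1 n5 n2 n4.symm
  have s1 := h.rot a e c hae n8 n6
  have s2 := h.rot a b c n3 n8 hbc
  have s3 := h.rot a c d n8 n1 n7.symm
  have s4 := h.rot e b c n5 n6 hbc
  have s5 := h.rot e c d n6 n2 n7.symm
  have s6 := h.rot b c d hbc n4.symm n7.symm
  have p1 := h.hR a c n8
  have p2 := h.hR e c n6
  have p3 := h.hR b c hbc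
  have p4 := h.hR d c n7
  unfold Crs
  grind

theorem Chiro.transL (h : Chiro R L) {a x y z : ι} (ax : R a x) (ay : R a y) (az : R a z)
    (xy : x ≠ y) (yz : y ≠ z) (xz : x ≠ z) (h1 : L a x y) (h2 : L a y z) : L a x z := by
  have g := h.hG3 a x y z (h.ne ax) (h.ne ay) (h.ne az) xy xz yz
  tauto

theorem Chiro.transR (h : Chiro R L) {a x y z : ι} (ax : R a x) (ay : R a y) (az : R a z)
    (h1 : R x y) (h2 : R y z) : R x z := by
  have xz : x ≠ z := by rintro rfl; exact h.asymm h1 h2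
  have g := h.hGN a x y z (h.ne ax) (h.ne ay) (h.ne az) (h.ne h1) xz (h.ne h2)
  tauto

end

theorem exists_min_rel {ι : Type} (r : ι → ι → Prop) (W : Finset ι) (hW : W.Nonempty)
    (tot : ∀ x ∈ W, ∀ y ∈ W, x ≠ y → r x y ∨ r y x)
    (tr : ∀ x ∈ W, ∀ y ∈ W, ∀ z ∈ W, x ≠ y → y ≠ z → x ≠ z → r x y → r y z → r x z) :
    ∃ m ∈ W, ∀ e ∈ W, e ≠ m → r m e := by
  induction hW using Finset.Nonempty.cons_induction with
  | singleton a => exact ⟨a, by simp, by simp⟩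
  | cons a s ha hs ih =>
    obtain ⟨m, hm, hmin⟩ := ih
      (fun x hx y hy => tot x (by simp [hx]) y (by simp [hy]))
      (fun x hx y hy z hz => tr x (by simp [hx]) y (by simp [hy]) z (by simp [hz]))
    have ham : a ≠ m := by rintro rfl; exact ha hm
    rcases tot a (by simp) m (by simp [hm]) ham with h | h
    · refine ⟨a, by simp, fun e he hne => ?_⟩
      rcases Finset.mem_cons.1 he with rfl | he'
      · exact absurd rfl hne
      · by_cases hem : e = m
        · rw [hem]; exact h
        · exact tr a (by simp) m (by simp [hm]) e (by simp [he']) ham (Ne.symm hem)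
            (Ne.symm hne) h (hmin e he' hem)
    · refine ⟨m, by simp [hm], fun e he hne => ?_⟩
      rcases Finset.mem_cons.1 he with rfl | he'
      · exact h
      · exact hmin e he' hne

set_option maxHeartbeats 2000000 in
/-- Linear bound for crossing-free edge sets. -/
theorem linear_bound {ι : Type} {R : ι → ι → Prop} {L : ι → ι → ι → Prop} (h : Chiro R L)
    (S : Finset ι) (E : Finset (ι × ι)) (hES : ∀ e ∈ E, e.1 ∈ S ∧ e.2 ∈ S)
    (hER : ∀ e ∈ E, R e.1 e.2)
    (hno : ∀ a b c d, (a, b) ∈ E → (c, d) ∈ E → a ≠ c → a ≠ d → b ≠ c → b ≠ d →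
      ¬ Crs L a b c d) : E.card ≤ 4 * S.card := by
  have hE : ∀ {a b}, (a, b) ∈ E → R a b := fun hab => hER _ hab
  have htotL : ∀ {a x y}, a ≠ x → a ≠ y → x ≠ y → L a x y ∨ L a y x := by
    intro a x y h1 h2 h3
    have := h.hL2 a x y h1 h2 h3
    tauto
  have hasL : ∀ {a x y}, R a x → R a y → x ≠ y → L a x y → ¬ L a y x := by
    intro a x y h1 h2 h3
    have := h.hL2 a x y (h.ne h1) (h.ne h2) h3
    tauto
  -- next edge, first event
  have key : ∀ e : ι × ι, e ∈ E → (∃ c, (e.1, c) ∈ E ∧ c ≠ e.2 ∧ L e.1 e.2 c) →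
      ∃ c d, (e.1, c) ∈ E ∧ c ≠ e.2 ∧ L e.1 e.2 c ∧
        (∀ c', (e.1, c') ∈ E → c' ≠ e.2 → L e.1 e.2 c' → c' ≠ c → L e.1 c c') ∧
        d ∈ S ∧ R e.1 d ∧ (d = e.2 ∨ L e.1 e.2 d) ∧ (d = c ∨ L e.1 d c) ∧
        (∀ f ∈ S, R e.1 f → (f = e.2 ∨ L e.1 e.2 f) → (f = c ∨ L e.1 f c) → f ≠ d → R d f) := by
    rintro ⟨a, b⟩ hab ⟨c0, hc0, hc0b, hc0L⟩
    simp only at *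
    obtain ⟨c, hc, hcmin⟩ := exists_min_rel (L a)
      (S.filter fun c => (a, c) ∈ E ∧ c ≠ b ∧ L a b c)
      ⟨c0, by simp only [Finset.mem_filter]; exact ⟨(hES _ hc0).2, hc0, hc0b, hc0L⟩⟩
      (by
        intro x hx y hy hxy
        simp only [Finset.mem_filter] at hx hy
        exact htotL (h.ne (hE hx.2.1)) (h.ne (hE hy.2.1)) hxy)
      (by
        intro x hx y hy z hz hxy hyz hxz h1 h2
        simp only [Finset.mem_filter] at hx hy hz
        exact h.transL (hE hx.2.1) (hE hy.2.1) (hE hz.2.1) hxy hyz hxz h1 h2)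
    simp only [Finset.mem_filter] at hc
    obtain ⟨d, hd, hdmin⟩ := exists_min_rel R
      (S.filter fun f => R a f ∧ (f = b ∨ L a b f) ∧ (f = c ∨ L a f c))
      ⟨c, by simp only [Finset.mem_filter]; refine ⟨hc.1, hE hc.2.1, Or.inr hc.2.2.2, Or.inl ?_⟩; trivial⟩
      (by
        intro x hx y hy hxy
        have := h.hR x y hxy
        tauto)
      (by
        intro x hx y hy z hz hxy hyz hxz h1 h2
        simp only [Finset.mem_filter] at hx hy hz
        exact h.transR hx.2.1 hy.2.1 hz.2.1 h1 h2)
    simp only [Finset.mem_filter] at hd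
    refine ⟨c, d, hc.2.1, hc.2.2.1, hc.2.2.2, ?_, hd.1, hd.2.1, hd.2.2.1, hd.2.2.2, ?_⟩
    · intro c' h1 h2 h3 h4
      exact hcmin c' (by simp only [Finset.mem_filter]; exact ⟨(hES _ h1).2, h1, h2, h3⟩) h4
    · intro f h1 h2 h3 h4 h5
      exact hdmin f (by simp only [Finset.mem_filter]; exact ⟨h1, h2, h3, h4⟩) h5
  rcases E.eq_empty_or_nonempty with hE0 | ⟨e0, -⟩
  · simp [hE0]
  have : Nonempty ι := ⟨e0.1⟩
  choose! C D hCE hCb hCL hCmin hDS hDR hDb hDc hDmin using key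
  set T : ι × ι → Prop := fun e => ∃ c, (e.1, c) ∈ E ∧ c ≠ e.2 ∧ L e.1 e.2 c with hT
  have htop : (E.filter fun e => ¬ T e).card ≤ S.card := by
    apply Finset.card_le_card_of_injOn Prod.fst
    · intro e he
      exact (hES e (Finset.mem_filter.1 he).1).1
    · rintro ⟨a, b⟩ he ⟨a', b'⟩ he' haa
      simp only at haa
      subst haa
      simp only [Finset.coe_filter, Set.mem_ofPred_eq, hT] at he he'
      by_contra hne
      have hbb : b ≠ b' := fun hb => hne (by rw [hb])
      rcases htotL (h.ne (hE he.1)) (h.ne (hE he'.1)) hbb with h1 | h1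
      · exact he.2 ⟨b', he'.1, hbb.symm, h1⟩
      · exact he'.2 ⟨b, he.1, hbb, h1⟩
  have hinj1 : (E.filter fun e => T e ∧ D e = e.2).card ≤ S.card := by
    apply Finset.card_le_card_of_injOn D
    · intro e he
      have he := Finset.mem_filter.1 he
      exact hDS e he.1 he.2.1
    · rintro ⟨a, b⟩ he ⟨a', b'⟩ he' hdd
      simp only [Finset.coe_filter, Set.mem_ofPred_eq] at he he'
      have hbb : b = b' := by rw [← he.2.2, hdd, he'.2.2]
      subst hbb
      by_contra hne
      have haa : a ≠ a' := fun hb => hne (by rw [hb])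
      have main : ∀ a a', a ≠ a' → (a, b) ∈ E → T (a, b) → D (a, b) = b → (a', b) ∈ E →
          L a b a' → False := by
        intro a a' haa h1 h2 h3 h4 h5
        have k1 := hCE _ h1 h2
        have k2 := hCL _ h1 h2
        have k3 := hDmin _ h1 h2
        have k4 := hCb _ h1 h2
        simp only at k1 k2 k3 k4
        rw [h3] at k3
        have k5 : R b (C (a, b)) :=
          k3 _ (hES _ k1).2 (hE k1) (Or.inr k2) (Or.inl rfl) k4
        have ha'b := h.ne (hE h4)
        refine hno _ _ _ _ h4 k1 haa.symm ?_ (h.ne (hE h1)).symm k4.symm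
          (h.T1 haa (hE h1) (hE h4) (hE k1) k5 k2 h5 ?_)
        · intro hh; rw [← hh] at k5; exact h.asymm k5 (hE h4)
        · rintro ⟨u1, u2⟩
          exact h.asymm (hE h4) (k3 a' (hES _ h4).1 u1 (Or.inr h5) (Or.inr u2) ha'b)
      have r1 := h.rot a b a' (h.ne (hE he.1)) haa (h.ne (hE he'.1)).symm
      by_cases hl : L a b a'
      · exact main a a' haa he.1 he.2.1 he.2.2 he'.1 hl
      · exact main a' a haa.symm he'.1 he'.2.1 he'.2.2 he.1 (by tauto)
  have hinj2 : (E.filter fun e => T e ∧ D e = C e).card ≤ S.card := by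
    apply Finset.card_le_card_of_injOn D
    · intro e he
      have he := Finset.mem_filter.1 he
      exact hDS e he.1 he.2.1
    · rintro ⟨a, b⟩ he ⟨a', b'⟩ he' hdd
      simp only [Finset.coe_filter, Set.mem_ofPred_eq] at he he'
      have hcc : C (a, b) = C (a', b') := by rw [← he.2.2, hdd, he'.2.2]
      by_contra hne
      by_cases haa : a = a'
      · subst haa
        have hbb : b ≠ b' := fun hb => hne (by rw [hb])
        have main : ∀ b b', b ≠ b' → (a, b) ∈ E → T (a, b) → (a, b') ∈ E → T (a, b') →
            C (a, b) = C (a, b') → L a b b' → False := by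
          intro b b' hbb h1 h2 h3 h4 h5 h6
          have k1 := hCmin _ h1 h2 b' h3 hbb.symm h6
          have k2 := hCL _ h3 h4
          have k3 := hCb _ h3 h4
          have k4 := hCE _ h3 h4
          simp only at k1 k2 k3 k4
          rw [h5] at k1
          exact hasL (hE h3) (hE k4) k3.symm k2 (k1 k3.symm)
        rcases htotL (h.ne (hE he.1)) (h.ne (hE he'.1)) hbb with h1 | h1
        · exact main b b' hbb he.1 he.2.1 he'.1 he'.2.1 hcc h1
        · exact main b' b hbb.symm he'.1 he'.2.1 he.1 he.2.1 hcc.symm h1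
      · have main : ∀ a b a' b', a ≠ a' → (a, b) ∈ E → T (a, b) → D (a, b) = C (a, b) →
            (a', b') ∈ E → T (a', b') → C (a, b) = C (a', b') → L a a' (C (a, b)) → False := by
          intro a b a' b' haa h1 h2 h3 h4 h4' h45 h5
          have k1 := hCE _ h1 h2
          have k2 := hCL _ h1 h2
          have k3 := hDmin _ h1 h2
          have k4 := hCb _ h1 h2
          have k6 := hCE _ h4 h4'
          rw [← h45] at k6
          simp only at k1 k2 k3 k4 k6
          rw [h3] at k3
          have k5 : R (C (a, b)) b :=
            k3 _ (hES _ h1).2 (hE h1) (Or.inl rfl) (Or.inr k2) k4.symm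
          have ha'b := h.ne (hE k6)
          refine hno _ _ _ _ k6 h1 haa.symm ?_ (h.ne (hE k1)).symm k4
            (h.T2 haa (hE k1) (hE k6) (hE h1) k5 k2 h5 ?_)
          · intro hh; exact h.asymm (show R (C (a, b)) a' by rw [hh]; exact k5) (hE k6)
          · rintro ⟨u1, u2⟩
            exact h.asymm (hE k6) (k3 a' (hES _ k6).1 u1 (Or.inr u2) (Or.inr h5) ha'b)
        have k1 := hCE _ he.1 he.2.1
        have k1' := hCE _ he'.1 he'.2.1
        rw [← hcc] at k1'
        have r1 := h.rot a a' (C (a, b)) haa (h.ne (hE k1)) (h.ne (hE k1'))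
        by_cases hl : L a a' (C (a, b))
        · exact main a b a' b' haa he.1 he.2.1 he.2.2 he'.1 he'.2.1 hcc hl
        · exact main a' b' a b (Ne.symm haa) he'.1 he'.2.1 he'.2.2 he.1 he.2.1 hcc.symm
            (by rw [← hcc]; tauto)
  have hinj3 : (E.filter fun e => T e ∧ D e ≠ e.2 ∧ D e ≠ C e).card ≤ S.card := by
    apply Finset.card_le_card_of_injOn D
    · intro e he
      have he := Finset.mem_filter.1 he
      exact hDS e he.1 he.2.1
    · rintro ⟨a, b⟩ he ⟨a', b'⟩ he' hdd
      simp only [Finset.coe_filter, Set.mem_ofPred_eq] at he he'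
      by_contra hne
      have facts : ∀ a b, (a, b) ∈ E → T (a, b) → D (a, b) ≠ b → D (a, b) ≠ C (a, b) →
          R a (D (a, b)) ∧ R (D (a, b)) b ∧ R (D (a, b)) (C (a, b)) ∧ L a b (D (a, b)) ∧
          L a (D (a, b)) (C (a, b)) ∧ (a, C (a, b)) ∈ E ∧ L a b (C (a, b)) := by
        intro a b h1 h2 h3 h4
        have k1 := hCE _ h1 h2
        have k2 := hCL _ h1 h2
        have k3 := hDmin _ h1 h2
        have k5 := hDb _ h1 h2
        have k6 := hDc _ h1 h2
        have k7 := hDR _ h1 h2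
        simp only at k1 k2 k3 k5 k6 k7
        refine ⟨k7, ?_, ?_, by tauto, by tauto, k1, k2⟩
        · exact k3 _ (hES _ h1).2 (hE h1) (Or.inl rfl) (Or.inr k2) h3.symm
        · exact k3 _ (hES _ k1).2 (hE k1) (Or.inr k2) (Or.inl rfl) h4.symm
      by_cases haa : a = a'
      · subst haa
        have hbb : b ≠ b' := fun hb => hne (by rw [hb])
        have main : ∀ b b', b ≠ b' → (a, b) ∈ E → T (a, b) → (a, b') ∈ E → T (a, b') →
            D (a, b) ≠ b → D (a, b) ≠ C (a, b) → D (a, b') ≠ b' → D (a, b') ≠ C (a, b') →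
            D (a, b) = D (a, b') → L a b b' → False := by
          intro b b' hbb h1 h2 h3 h4 h5 h6 h7 h8 h9 h10
          obtain ⟨f1, f2, f3, f4, f5, f6, f7⟩ := facts _ _ h1 h2 h5 h6
          obtain ⟨g1, g2, g3, g4, g5, g6, g7⟩ := facts _ _ h3 h4 h7 h8
          rw [← h9] at g1 g2 g3 g4 g5 h7
          have hb'c : b' ≠ C (a, b) := by
            intro hh
            rw [hh] at g4 h7
            exact hasL (hE f6) f1 h7.symm g4 f5
          have k0 := h.transL (hE h3) f1 (hE f6) h7.symm h6 hb'c g4 f5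
          exact hasL (hE h3) (hE f6) hb'c k0 (hCmin _ h1 h2 b' h3 hbb.symm h10 hb'c)
        rcases htotL (h.ne (hE he.1)) (h.ne (hE he'.1)) hbb with h1 | h1
        · exact main b b' hbb he.1 he.2.1 he'.1 he'.2.1 he.2.2.1 he.2.2.2 he'.2.2.1 he'.2.2.2
            hdd h1
        · exact main b' b hbb.symm he'.1 he'.2.1 he.1 he.2.1 he'.2.2.1 he'.2.2.2 he.2.2.1
            he.2.2.2 hdd.symm h1
      · have main : ∀ a b a' b', R a a' → (a, b) ∈ E → T (a, b) → (a', b') ∈ E → T (a', b') →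
            D (a, b) ≠ b → D (a, b) ≠ C (a, b) → D (a', b') ≠ b' → D (a', b') ≠ C (a', b') →
            D (a, b) = D (a', b') → False := by
          intro a b a' b' haa h1 h2 h3 h4 h5 h6 h7 h8 h9
          obtain ⟨f1, f2, f3, f4, f5, f6, f7⟩ := facts _ _ h1 h2 h5 h6
          obtain ⟨g1, g2, g3, g4, g5, g6, g7⟩ := facts _ _ h3 h4 h7 h8
          have k3 := hDmin _ h1 h2
          simp only at k3
          rw [← h9] at g1 g2 g3 g4 g5 h7
          have a'd := h.ne g1
          have a'b : a' ≠ b := by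
            intro hh; exact h.asymm (show R (D (a, b)) a' by rw [hh]; exact f2) g1
          have a'c : a' ≠ C (a, b) := by
            intro hh; rw [← hh] at f3; exact h.asymm f3 g1
          have ac' : a ≠ C (a', b') := by
            intro hh; rw [← hh] at g3; exact h.asymm g3 f1
          have ab' : a ≠ b' := by
            intro hh; rw [← hh] at g2; exact h.asymm g2 f1
          have hout : L a a' b ∨ L a (C (a, b)) a' := by
            by_contra hcon
            push Not at hcon
            have u1 := htotL (h.ne haa) (h.ne (hE h1)) a'b
            have u2 := htotL (h.ne haa) (h.ne (hE f6)) a'c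
            exact h.asymm g1 (k3 a' (hES _ h3).1 haa (Or.inr (by tauto)) (Or.inr (by tauto)) a'd)
          rcases hout with h0 | h0
          · obtain ⟨w1, w2⟩ := h.T3 haa f1 g1 (hE h1) f2 (hE g6) g3 (Or.inl ⟨f4, g5, h0⟩)
            exact hno _ _ _ _ h1 g6 (h.ne haa) ac' a'b.symm w1 w2
          · obtain ⟨w1, w2⟩ := h.T3 haa f1 g1 (hE f6) f3 (hE h3) g2 (Or.inr ⟨f5, g4, h0⟩)
            exact hno _ _ _ _ f6 h3 (h.ne haa) ab' a'c.symm w1 w2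
        have := h.hR a a' haa
        by_cases hr : R a a'
        · exact main a b a' b' hr he.1 he.2.1 he'.1 he'.2.1 he.2.2.1 he.2.2.2 he'.2.2.1
            he'.2.2.2 hdd
        · exact main a' b' a b (by tauto) he'.1 he'.2.1 he.1 he.2.1 he'.2.2.1
            he'.2.2.2 he.2.2.1 he.2.2.2 hdd.symm
  have hcover : E ⊆ ((E.filter fun e => ¬ T e) ∪ (E.filter fun e => T e ∧ D e = e.2)) ∪
      ((E.filter fun e => T e ∧ D e = C e) ∪ (E.filter fun e => T e ∧ D e ≠ e.2 ∧ D e ≠ C e)) := by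
    intro e he
    simp only [Finset.mem_union, Finset.mem_filter]
    clear_value T
    by_cases t1 : T e <;> by_cases t2 : D e = e.2 <;> by_cases t3 : D e = C e <;>
      simp [he, t1, t2, t3]
  have c0 := Finset.card_le_card hcover
  have c1 := Finset.card_union_le
    ((E.filter fun e => ¬ T e) ∪ (E.filter fun e => T e ∧ D e = e.2))
    ((E.filter fun e => T e ∧ D e = C e) ∪ (E.filter fun e => T e ∧ D e ≠ e.2 ∧ D e ≠ C e))
  have c2 := Finset.card_union_le (E.filter fun e => ¬ T e) (E.filter fun e => T e ∧ D e = e.2)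
  have c3 := Finset.card_union_le (E.filter fun e => T e ∧ D e = C e)
    (E.filter fun e => T e ∧ D e ≠ e.2 ∧ D e ≠ C e)
  omega


theorem card_fun_zero {ι : Type} [Fintype ι] (t : ℕ) (T : Finset ι) :
    ((Finset.univ : Finset (ι → Fin (t + 1))).filter fun f => ∀ i ∈ T, f i = 0).card
      * (t + 1) ^ T.card = (t + 1) ^ Fintype.card ι := by
  have h1 : ((Finset.univ : Finset (ι → Fin (t + 1))).filter fun f => ∀ i ∈ T, f i = 0) =
      Fintype.piFinset (fun i => if i ∈ T then {(0 : Fin (t + 1))} else Finset.univ) := by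
    ext f
    simp only [Finset.mem_filter, Finset.mem_univ, true_and, Fintype.mem_piFinset]
    refine forall_congr' fun i => ?_
    by_cases hi : i ∈ T <;> simp [hi]
  rw [h1, Fintype.card_piFinset]
  have h2 : ∀ i, (if i ∈ T then {(0 : Fin (t + 1))} else Finset.univ : Finset (Fin (t+1))).card =
      if i ∈ T then 1 else (t + 1) := by
    intro i; by_cases hi : i ∈ T <;> simp [hi]
  simp only [h2]
  rw [Finset.prod_ite, Finset.prod_const_one, one_mul, Finset.prod_const, ← pow_add]
  congr 1
  have h3 : (Finset.univ.filter fun i => i ∉ T) = Finset.univ \ T := by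
    ext; simp
  rw [h3, Finset.card_sdiff_add_card_eq_card (Finset.subset_univ _), Finset.card_univ]

/-- Double counting: sum over colourings of the number of objects whose support has colour 0. -/
theorem sum_card_zero {ι α : Type} [Fintype ι] (t r : ℕ) (A : Finset α) (sup : α → Finset ι)
    (hs : ∀ x ∈ A, (sup x).card = r) :
    (∑ f : ι → Fin (t + 1), (A.filter fun x => ∀ i ∈ sup x, f i = 0).card) * (t + 1) ^ r =
      A.card * (t + 1) ^ Fintype.card ι := by
  have h1 : (∑ f : ι → Fin (t + 1), (A.filter fun x => ∀ i ∈ sup x, f i = 0).card) =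
      ∑ x ∈ A, ((Finset.univ : Finset (ι → Fin (t + 1))).filter
        fun f => ∀ i ∈ sup x, f i = 0).card := by
    simp only [Finset.card_filter]
    exact Finset.sum_comm
  rw [h1, Finset.sum_mul]
  rw [Finset.sum_congr rfl (g := fun _ => (t + 1) ^ Fintype.card ι)]
  · simp
  · intro x hx
    rw [← hs x hx]
    exact card_fun_zero t (sup x)

theorem sampling {ι : Type} [Fintype ι] (E : Finset (ι × ι)) (Y : Finset ((ι × ι) × (ι × ι)))
    (hE : ∀ e ∈ E, e.1 ≠ e.2)
    (hY : ∀ q ∈ Y, q.1 ∈ E ∧ q.2 ∈ E ∧ q.1.1 ≠ q.2.1 ∧ q.1.1 ≠ q.2.2 ∧ q.1.2 ≠ q.2.1 ∧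
      q.1.2 ≠ q.2.2)
    (H : ∀ (S : Finset ι) (E' : Finset (ι × ι)), E' ⊆ E → (∀ e ∈ E', e.1 ∈ S ∧ e.2 ∈ S) →
      (∀ e ∈ E', ∀ f ∈ E', (e, f) ∉ Y) → E'.card ≤ 4 * S.card) (t : ℕ) :
    t ^ 2 * E.card ≤ 4 * Fintype.card ι * t ^ 3 + Y.card := by
  rcases t with _ | t
  · simp
  have hA := sum_card_zero t 2 E (fun e => {e.1, e.2})
    (fun e he => Finset.card_pair (hE e he))
  have hB := sum_card_zero t 4 Y (fun q => {q.1.1, q.1.2, q.2.1, q.2.2}) (by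
    intro q hq
    obtain ⟨h1, h2, h3, h4, h5, h6⟩ := hY q hq
    have h7 := hE _ h1
    have h8 := hE _ h2
    rw [Finset.card_insert_of_notMem, Finset.card_insert_of_notMem, Finset.card_pair h8] <;>
      simp <;> tauto)
  have hC := sum_card_zero (ι := ι) t 1 Finset.univ (fun i : ι => {i}) (by simp)
  have step : ∀ f : ι → Fin (t + 1),
      (E.filter fun x => ∀ i ∈ ({x.1, x.2} : Finset ι), f i = 0).card ≤
      4 * ((Finset.univ : Finset ι).filter fun x => ∀ i ∈ ({x} : Finset ι), f i = 0).card +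
      (Y.filter fun q => ∀ i ∈ ({q.1.1, q.1.2, q.2.1, q.2.2} : Finset ι), f i = 0).card := by
    intro f
    set E0 := E.filter fun x => ∀ i ∈ ({x.1, x.2} : Finset ι), f i = 0 with hE0
    set Y0 := Y.filter fun q => ∀ i ∈ ({q.1.1, q.1.2, q.2.1, q.2.2} : Finset ι), f i = 0 with hY0
    have h1 := H ((Finset.univ : Finset ι).filter fun x => ∀ i ∈ ({x} : Finset ι), f i = 0)
      (E0 \ Y0.image Prod.fst) (by
        intro e he
        exact (Finset.mem_filter.1 (Finset.mem_sdiff.1 he).1).1) (by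
        intro e he
        have := (Finset.mem_filter.1 (Finset.mem_sdiff.1 he).1).2
        simp at this
        simp [this]) (by
        intro e he g hg hq
        have h1 := (Finset.mem_filter.1 (Finset.mem_sdiff.1 he).1).2
        have h2 := (Finset.mem_filter.1 (Finset.mem_sdiff.1 hg).1).2
        apply (Finset.mem_sdiff.1 he).2
        refine Finset.mem_image.2 ⟨(e, g), ?_, rfl⟩
        rw [hY0, Finset.mem_filter]
        refine ⟨hq, ?_⟩
        simp at h1 h2
        simp [h1, h2])
    have h2 := Finset.le_card_sdiff (Y0.image Prod.fst) E0
    have h3 : (Y0.image Prod.fst).card ≤ Y0.card := Finset.card_image_le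
    omega
  have hsum := Finset.sum_le_sum (s := Finset.univ) fun f _ => step f
  rw [Finset.sum_add_distrib, ← Finset.mul_sum] at hsum
  set A := ∑ f : ι → Fin (t + 1), (E.filter fun x => ∀ i ∈ ({x.1, x.2} : Finset ι), f i = 0).card
  set B := ∑ f : ι → Fin (t + 1), (Y.filter fun q =>
    ∀ i ∈ ({q.1.1, q.1.2, q.2.1, q.2.2} : Finset ι), f i = 0).card
  set C := ∑ f : ι → Fin (t + 1),
    ((Finset.univ : Finset ι).filter fun x => ∀ i ∈ ({x} : Finset ι), f i = 0).card
  rw [Finset.card_univ] at hC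
  set P := (t + 1) ^ Fintype.card ι with hP
  have hPpos : 0 < P := by positivity
  apply Nat.le_of_mul_le_mul_right _ hPpos
  calc (t + 1) ^ 2 * E.card * P = (t + 1) ^ 2 * (E.card * P) := by ring
    _ = (t + 1) ^ 4 * A := by rw [← hA]; ring
    _ ≤ (t + 1) ^ 4 * (4 * C + B) := by gcongr
    _ = 4 * (t + 1) ^ 3 * (C * (t + 1) ^ 1) + B * (t + 1) ^ 4 := by ring
    _ = _ := by rw [hB, hC]; ring

theorem aux_pos_neg {k : ℝ} (hk : k < 0) (x : ℝ) : 0 < k * x ↔ x < 0 := by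
  constructor <;> intro h <;> nlinarith

theorem aux_neg_neg {k : ℝ} (hk : k < 0) (x : ℝ) : k * x < 0 ↔ 0 < x := by
  constructor <;> intro h <;> nlinarith

theorem aux_neg_pos {k : ℝ} (hk : 0 < k) (x : ℝ) : k * x < 0 ↔ x < 0 := by
  constructor <;> intro h <;> nlinarith


/-- `f` changes sign exactly once, at `z`. -/
def SC (f : ℝ → ℝ) (z : ℝ) : Prop :=
  (∀ x, (0 < f x ↔ z < x) ∧ (f x < 0 ↔ x < z)) ∨ (∀ x, (0 < f x ↔ x < z) ∧ (f x < 0 ↔ z < x))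

theorem exists_zero_between (f : ℝ → ℝ) (hf : Continuous f) (x y : ℝ) (hx : f x < 0)
    (hy : 0 < f y) : ∃ w ∈ Set.uIcc x y, f w = 0 := by
  have h := intermediate_value_uIcc (hf.continuousOn (s := Set.uIcc x y))
  have h0 : (0 : ℝ) ∈ Set.uIcc (f x) (f y) := by
    rw [Set.mem_uIcc]; left; exact ⟨hx.le, hy.le⟩
  obtain ⟨w, hw, hw0⟩ := h h0
  exact ⟨w, hw, hw0⟩

theorem SC_of (f : ℝ → ℝ) (hf : Continuous f) (h0 : ∃! x, f x = 0) (h1 : ∃ x, f x < 0)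
    (h2 : ∃ x, 0 < f x) : ∃ z, SC f z := by
  obtain ⟨z, hz, huniq⟩ := h0
  simp only at hz huniq
  obtain ⟨u, hu⟩ := h1
  obtain ⟨v, hv⟩ := h2
  have key : ∀ x y, f x < 0 → 0 < f y → (x < z ∧ z < y) ∨ (y < z ∧ z < x) := by
    intro x y hx hy
    obtain ⟨w, hw, hw0⟩ := exists_zero_between f hf x y hx hy
    have := huniq w hw0
    subst this
    have hxw : x ≠ w := by rintro rfl; linarith
    have hyw : y ≠ w := by rintro rfl; linarith
    rcases Set.mem_uIcc.1 hw with h | h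
    · left; exact ⟨lt_of_le_of_ne h.1 hxw, lt_of_le_of_ne h.2 hyw.symm⟩
    · right; exact ⟨lt_of_le_of_ne h.1 hyw, lt_of_le_of_ne h.2 hxw.symm⟩
  have tri : ∀ x, x ≠ z → f x < 0 ∨ 0 < f x := by
    intro x hx
    exact lt_or_gt_of_ne fun h => hx (huniq x h)
  refine ⟨z, ?_⟩
  rcases key u v hu hv with ⟨a1, a2⟩ | ⟨a1, a2⟩
  · left
    have hneg : ∀ x, f x < 0 → x < z := by
      intro x hx
      rcases key x v hx hv with h | h
      · exact h.1
      · linarith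
    have hpos : ∀ x, 0 < f x → z < x := by
      intro x hx
      rcases key u x hu hx with h | h
      · exact h.2
      · linarith
    intro x
    refine ⟨⟨hpos x, fun h => ?_⟩, ⟨hneg x, fun h => ?_⟩⟩
    · rcases tri x h.ne' with h' | h'
      · linarith [hneg x h']
      · exact h'
    · rcases tri x h.ne with h' | h'
      · exact h'
      · linarith [hpos x h']
  · right
    have hneg : ∀ x, f x < 0 → z < x := by
      intro x hx
      rcases key x v hx hv with h | h
      · linarith
      · exact h.2
    have hpos : ∀ x, 0 < f x → x < z := by
      intro x hx
      rcases key u x hu hx with h | h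
      · linarith
      · exact h.1
    intro x
    refine ⟨⟨hpos x, fun h => ?_⟩, ⟨hneg x, fun h => ?_⟩⟩
    · rcases tri x h.ne with h' | h'
      · linarith [hneg x h']
      · exact h'
    · rcases tri x h.ne' with h' | h'
      · exact h'
      · linarith [hpos x h']

theorem SC.neg {f : ℝ → ℝ} {z : ℝ} (h : SC f z) : SC (fun x => - f x) z := by
  unfold SC at *
  simp only [Left.neg_pos_iff, Left.neg_neg_iff]
  rcases h with h | h
  · right; intro x; exact ⟨(h x).2, (h x).1⟩
  · left; intro x; exact ⟨(h x).2, (h x).1⟩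

theorem SC.mul {f : ℝ → ℝ} {z : ℝ} (h : SC f z) (k : ℝ) (hk : k ≠ 0) :
    SC (fun x => k * f x) z := by
  unfold SC at *
  rcases lt_or_gt_of_ne hk with hk | hk
  · simp only [aux_pos_neg hk, aux_neg_neg hk]
    rcases h with h | h
    · right; intro x; exact ⟨(h x).2, (h x).1⟩
    · left; intro x; exact ⟨(h x).2, (h x).1⟩
  · simpa only [mul_pos_iff_of_pos_left hk, aux_neg_pos hk] using h

theorem SC.zero {f : ℝ → ℝ} {z : ℝ} (h : SC f z) (x : ℝ) : f x = 0 ↔ x = z := by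
  constructor
  · intro h0
    by_contra hx
    rcases h with h | h <;> have h1 := h x <;> rcases lt_or_gt_of_ne hx with h2 | h2
    · linarith [h1.2.2 h2]
    · linarith [h1.1.2 h2]
    · linarith [h1.1.2 h2]
    · linarith [h1.2.2 h2]
  · rintro rfl
    by_contra hx
    rcases h with h | h <;> have h1 := h x <;> rcases lt_or_gt_of_ne hx with h2 | h2
    · linarith [h1.2.1 h2]
    · linarith [h1.1.1 h2]
    · linarith [h1.2.1 h2]
    · linarith [h1.1.1 h2]

theorem near {I : Type} (s : Finset I) (hs : s.Nonempty) (f : I → ℝ → ℝ) (z : I → ℝ)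
    (hSC : ∀ i ∈ s, SC (f i) (z i)) (x0 : ℝ) (h : ∀ i ∈ s, 0 ≤ f i x0) :
    ∃ i ∈ s, ∀ j ∈ s, 0 ≤ f j (z i) := by
  obtain ⟨i, hi, hmin⟩ := Finset.exists_min_image s (fun i => |z i - x0|) hs
  refine ⟨i, hi, fun j hj => ?_⟩
  have h1 := hmin j hj
  have h2 := h j hj
  by_contra hneg
  push Not at hneg
  rcases hSC j hj with h3 | h3
  · have h4 := (h3 (z i)).2.1 hneg
    have h5 : z j ≤ x0 := by
      by_contra h6
      push Not at h6
      linarith [(h3 x0).2.2 h6]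
    rw [abs_of_nonpos (by linarith : z j - x0 ≤ 0), abs_of_nonpos (by linarith)] at h1
    linarith
  · have h4 := (h3 (z i)).2.1 hneg
    have h5 : x0 ≤ z j := by
      by_contra h6
      push Not at h6
      linarith [(h3 x0).2.2 h6]
    rw [abs_of_nonneg (by linarith : 0 ≤ z j - x0), abs_of_nonneg (by linarith)] at h1
    linarith

/-- Containment of a curve in a corridor from sign data at two of its points. -/
theorem contain (P C D : ℝ → ℝ) (zP zC zD r : ℝ) (hP : SC P zP) (hC : SC C zC) (hD : SC D zD)
    (h1 : C zP * D zP < 0) (h2 : P r * C r < 0) (h3 : P r * D r < 0) (x : ℝ) :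
    (P x < 0 ∨ C x < 0 ∨ D x < 0) ∧ (0 < P x ∨ 0 < C x ∨ 0 < D x) := by
  rw [mul_neg_iff] at h1 h2 h3
  rcases hP with hP | hP <;> rcases hC with hC | hC <;> rcases hD with hD | hD <;>
  · simp only [hP, hC, hD] at *
    grind

theorem plane_side (a p : PP) (φ : ℝ → ℝ) (ha : Continuous fun q : ℝ × ℝ => a q.1 q.2)
    (hp : Continuous fun q : ℝ × ℝ => p q.1 q.2) (hφ : IsGraphFun p a φ)
    (h1 : ∃ x y, a x y < p x y) (h2 : ∃ x y, p x y < a x y) :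
    ∃ t : ℝ, t ≠ 0 ∧ ∀ x y, (p x y < a x y ↔ 0 < t * (y - φ x)) ∧
      (a x y < p x y ↔ t * (y - φ x) < 0) := by
  obtain ⟨hφc, hφz⟩ := hφ
  have key : ∀ x h x' h', a x (φ x + h) < p x (φ x + h) → p x' (φ x' + h') < a x' (φ x' + h') →
      h * h' < 0 := by
    intro x h x' h' H1 H2
    obtain ⟨w, hw, hw0⟩ := exists_zero_between
      (fun s => a (x + s * (x' - x)) (φ (x + s * (x' - x)) + (h + s * (h' - h))) -
        p (x + s * (x' - x)) (φ (x + s * (x' - x)) + (h + s * (h' - h))))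
      (by
        have c1 : Continuous fun s : ℝ =>
          ((x + s * (x' - x), φ (x + s * (x' - x)) + (h + s * (h' - h))) : ℝ × ℝ) := by
          fun_prop
        exact (ha.comp c1).sub (hp.comp c1)) 0 1 (by simpa using H1) (by simpa using H2)
    have h3 := (hφz _ _).1 (sub_eq_zero.1 hw0).symm
    rw [Set.uIcc_of_le zero_le_one] at hw
    have h4 : h + w * (h' - h) = 0 := by linarith
    have hne : h ≠ 0 := by
      rintro rfl
      have := (hφz x (φ x + 0)).2 (by simp)
      linarith
    have hne' : h' ≠ 0 := by
      rintro rfl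
      have := (hφz x' (φ x' + 0)).2 (by simp)
      linarith
    by_contra hcon
    push Not at hcon
    have hpos : 0 < h * h' := lt_of_le_of_ne hcon (mul_ne_zero hne hne').symm
    rcases pos_and_pos_or_neg_and_neg_of_mul_pos hpos with ⟨i1, i2⟩ | ⟨i1, i2⟩
    · have : h + w * (h' - h) = (1 - w) * h + w * h' := by ring
      rcases hw.1.eq_or_lt with e | e
      · rw [← e] at h4; linarith
      · have := mul_pos e i2
        have := mul_nonneg (sub_nonneg.2 hw.2) i1.le
        linarith
    · have : h + w * (h' - h) = (1 - w) * h + w * h' := by ring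
      rcases hw.1.eq_or_lt with e | e
      · rw [← e] at h4; linarith
      · have := mul_neg_of_pos_of_neg e i2
        have := mul_nonpos_of_nonneg_of_nonpos (sub_nonneg.2 hw.2) i1.le
        linarith
  have key' : ∀ x y x' y', a x y < p x y → p x' y' < a x' y' →
      (y - φ x) * (y' - φ x') < 0 := by
    intro x y x' y' H1 H2
    exact key x _ x' _ (by simpa using H1) (by simpa using H2)
  obtain ⟨u, v, huv⟩ := h1
  obtain ⟨u', v', huv'⟩ := h2
  have hk := key' _ _ _ _ huv huv'
  refine ⟨v' - φ u', fun h0 => by rw [h0] at hk; simp at hk, fun x y => ?_⟩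
  have hz := hφz x y
  have A1 : p x y < a x y → 0 < (v' - φ u') * (y - φ x) := by
    intro H
    have k2 := key' _ _ _ _ huv H
    rw [mul_neg_iff] at hk k2
    rw [mul_pos_iff]
    grind
  have A2 : a x y < p x y → (v' - φ u') * (y - φ x) < 0 := by
    intro H
    have k2 := key' _ _ _ _ H huv'
    linarith
  rcases lt_trichotomy (p x y) (a x y) with h | h | h
  · have := A1 h
    constructor <;> constructor <;> intro <;> linarith
  · have h3 := hz.1 h
    rw [h3]
    simp
    rw [← h3, h]
    simp
  · have := A2 h
    constructor <;> constructor <;> intro <;> linarith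

theorem curveSC {Λ : Finset PP} (hΛ : PseudoplaneFamily Λ) {a b c : PP} (ha : a ∈ Λ) (hb : b ∈ Λ)
    (hc : c ∈ Λ) (hab : a ≠ b) (hac : a ≠ c) (hbc : b ≠ c) {φ : ℝ → ℝ} (hφ : IsGraphFun a b φ) :
    ∃ z, SC (fun x => c x (φ x) - a x (φ x)) z := by
  obtain ⟨H1, H2, H3, H4, H5, H6, H7⟩ := hΛ
  obtain ⟨h1, h2⟩ := H7 a ha b hb c hc hab hac hbc φ hφ
  apply SC_of
  · have c1 : Continuous fun s : ℝ => ((s, φ s) : ℝ × ℝ) := by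
      have := hφ.1
      fun_prop
    exact ((H1 c hc).comp c1).sub ((H1 a ha).comp c1)
  · obtain ⟨q, hq, hu⟩ := H3 a ha b hb c hc hab hac hbc
    simp only at hq hu
    refine ⟨q.1, ?_, ?_⟩
    · show c q.1 (φ q.1) - a q.1 (φ q.1) = 0
      rw [← (hφ.2 _ _).1 hq.1]
      linarith [hq.2]
    · intro x hx
      have := hu (x, φ x) ⟨(hφ.2 _ _).2 rfl, by simp only; linarith⟩
      rw [← this]
  · obtain ⟨x, hx⟩ := h1; exact ⟨x, by linarith⟩
  · obtain ⟨x, hx⟩ := h2; exact ⟨x, by linarith⟩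

theorem verticalSC (a p : PP) (φ : ℝ → ℝ) (t : ℝ) (ht : t ≠ 0)
    (h : ∀ x y, (p x y < a x y ↔ 0 < t * (y - φ x)) ∧ (a x y < p x y ↔ t * (y - φ x) < 0))
    (x : ℝ) : SC (fun y => a x y - p x y) (φ x) := by
  unfold SC
  simp only [sub_pos, sub_neg, h]
  rcases lt_or_gt_of_ne ht with ht | ht
  · right; intro y
    simp only [aux_pos_neg ht, aux_neg_neg ht, sub_neg, sub_pos, and_self]
  · left; intro y
    simp only [mul_pos_iff_of_pos_left ht, aux_neg_pos ht, sub_neg, sub_pos, and_self]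

/-- At the common point of `p,u,v`, the surfaces `w` and `z` are on opposite sides of `p`. -/
def Opp (p u v w z : PP) : Prop :=
  ∀ x y, u x y = p x y → v x y = p x y → (w x y - p x y) * (z x y - p x y) < 0

/-- At the common point of `p,u,v`, the surfaces `w` and `z` are on the same side of `p`. -/
def Sam (p u v w z : PP) : Prop :=
  ∀ x y, u x y = p x y → v x y = p x y → 0 < (w x y - p x y) * (z x y - p x y)

/-- The crossing condition at `p`. -/
def Crossing (p a b c d : PP) : Prop :=
  Opp p a b c d ∧ Opp p c d a b ∧ Sam p a c b d ∧ Sam p a d b c ∧ Sam p b c a d ∧ Sam p b d a c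

theorem exclude {Λ : Finset PP} (hΛ : PseudoplaneFamily Λ) {p : PP} (hp : p ∈ Λ) (Q : Finset PP)
    (hQ : Q ⊆ Λ.erase p) (hQ2 : 2 ≤ Q.card) (κ : PP → ℝ) (hκ : ∀ u ∈ Q, κ u ≠ 0) (x y : ℝ)
    (h : ∀ u ∈ Q, 0 ≤ κ u * (u x y - p x y)) :
    ∃ u ∈ Q, ∃ w ∈ Q, u ≠ w ∧ ∃ x y, u x y = p x y ∧ w x y = p x y ∧
      ∀ z ∈ Q, 0 ≤ κ z * (z x y - p x y) := by
  have hmem : ∀ u ∈ Q, u ≠ p ∧ u ∈ Λ := fun u hu => Finset.mem_erase.1 (hQ hu)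
  have hφ : ∀ u : PP, ∃ φ : ℝ → ℝ, u ∈ Q → IsGraphFun p u φ := by
    intro u
    by_cases hu : u ∈ Q
    · obtain ⟨φ, hφ⟩ := hΛ.2.1 p hp u (hmem u hu).2 (hmem u hu).1.symm
      exact ⟨φ, fun _ => hφ⟩
    · exact ⟨fun _ => 0, fun h => absurd h hu⟩
  choose φ hφ using hφ
  have hne : Q.Nonempty := Finset.card_pos.1 (by omega)
  obtain ⟨u, hu, hu'⟩ := near Q hne (fun u y => κ u * (u x y - p x y)) (fun u => φ u x) (by
    intro u hu
    obtain ⟨t, ht, htt⟩ := plane_side u p (φ u) (hΛ.1 u (hmem u hu).2) (hΛ.1 p hp) (hφ u hu)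
      (hΛ.2.2.2.2.2.1 u (hmem u hu).2 p hp (hmem u hu).1).1
      (hΛ.2.2.2.2.2.1 u (hmem u hu).2 p hp (hmem u hu).1).2
    exact (verticalSC u p (φ u) t ht htt x).mul (κ u) (hκ u hu)) y h
  have hz : ∀ w : PP, ∃ z : ℝ, w ∈ Q.erase u →
      SC (fun x => w x (φ u x) - p x (φ u x)) z := by
    intro w
    by_cases hw : w ∈ Q.erase u
    · have hw' := Finset.mem_erase.1 hw
      obtain ⟨z, hz⟩ := curveSC hΛ hp (hmem u hu).2 (hmem w hw'.2).2 (hmem u hu).1.symm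
        (hmem w hw'.2).1.symm hw'.1.symm (hφ u hu)
      exact ⟨z, fun _ => hz⟩
    · exact ⟨0, fun h => absurd h hw⟩
  choose z hz using hz
  have hne2 : (Q.erase u).Nonempty := by
    apply Finset.card_pos.1
    rw [Finset.card_erase_of_mem hu]; omega
  obtain ⟨w, hw, hw'⟩ := near (Q.erase u) hne2
    (fun w x => κ w * (w x (φ u x) - p x (φ u x))) z
    (fun w hw => (hz w hw).mul (κ w) (hκ w (Finset.mem_erase.1 hw).2)) x
    (fun w hw => hu' w (Finset.mem_erase.1 hw).2)
  have e1 : u (z w) (φ u (z w)) = p (z w) (φ u (z w)) := (((hφ u hu).2 _ _).2 rfl).symm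
  refine ⟨u, hu, w, (Finset.mem_erase.1 hw).2, (Finset.mem_erase.1 hw).1.symm, z w, φ u (z w),
    e1, ?_, ?_⟩
  · exact sub_eq_zero.1 (((hz w hw).zero (z w)).2 rfl)
  · intro v hv
    by_cases hvu : v = u
    · subst hvu; rw [e1]; simp
    · exact hw' v (Finset.mem_erase.2 ⟨hvu, hv⟩)

theorem half {Λ : Finset PP} (hΛ : PseudoplaneFamily Λ) {p a b c d : PP} (hp : p ∈ Λ)
    (ha : a ∈ Λ) (hb : b ∈ Λ) (hc : c ∈ Λ) (hd : d ∈ Λ) (pa : p ≠ a) (pb : p ≠ b) (pc : p ≠ c)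
    (pd : p ≠ d) (ab : a ≠ b) (ac : a ≠ c) (ad : a ≠ d) (bc : b ≠ c) (bd : b ≠ d)
    (hO : Opp p a b c d) (x y : ℝ) (h1 : a x y = b x y) (h2 : c x y = d x y)
    (h3 : (p x y - a x y) * (c x y - a x y) < 0) : Immersed {p, a, b} {p, c, d} := by
  have e1 : ({p, a, b} : Finset PP) ∩ {p, c, d} = {p} := by
    ext s; simp only [Finset.mem_inter, Finset.mem_insert, Finset.mem_singleton]
    grind
  have e2 : ({p, a, b} : Finset PP) \ {p, c, d} = {a, b} := by
    ext s; simp only [Finset.mem_sdiff, Finset.mem_insert, Finset.mem_singleton]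
    grind
  refine ⟨by rw [e1]; simp, ?_⟩
  rw [e2]
  rintro ⟨x', y', z'⟩ hmem
  obtain ⟨φ, hφ⟩ := hΛ.2.1 a ha b hb ab
  have q1 : a x' y' = z' := hmem a (by simp)
  have q2 : b x' y' = z' := hmem b (by simp)
  have q3 : y' = φ x' := (hφ.2 _ _).1 (q1.trans q2.symm)
  obtain ⟨zP, hP⟩ := curveSC hΛ ha hb hp ab pa.symm pb.symm hφ
  obtain ⟨zC, hC⟩ := curveSC hΛ ha hb hc ab ac bc hφ
  obtain ⟨zD, hD⟩ := curveSC hΛ ha hb hd ab ad bd hφ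
  have q4 : y = φ x := (hφ.2 _ _).1 h1
  have z1 := (hP.zero zP).2 rfl
  have z2 := (hφ.2 zP (φ zP)).2 rfl
  have hh := contain _ _ _ zP zC zD x hP hC hD
    (by
      have := hO zP (φ zP) (by linarith) (by linarith)
      rw [show a zP (φ zP) = p zP (φ zP) by linarith]
      exact this)
    (by rw [← q4]; exact h3) (by rw [← q4, ← h2]; exact h3) x'
  rw [← q3, q1] at hh
  simp only [sub_pos, sub_neg] at hh
  simp only [corridorSet, Set.mem_ofPred_eq, Finset.mem_insert, Finset.mem_singleton,
    exists_eq_or_imp, exists_eq_left]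
  exact hh

theorem immersion {Λ : Finset PP} (hΛ : PseudoplaneFamily Λ) {p a b c d : PP} (hp : p ∈ Λ)
    (ha : a ∈ Λ) (hb : b ∈ Λ) (hc : c ∈ Λ) (hd : d ∈ Λ) (pa : p ≠ a) (pb : p ≠ b) (pc : p ≠ c)
    (pd : p ≠ d) (ab : a ≠ b) (ac : a ≠ c) (ad : a ≠ d) (bc : b ≠ c) (bd : b ≠ d) (cd : c ≠ d)
    (hX : Crossing p a b c d) :
    Immersed {p, a, b} {p, c, d} ∨ Immersed {p, c, d} {p, a, b} := by
  obtain ⟨φ, hφ⟩ := hΛ.2.1 a ha b hb ab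
  obtain ⟨ψ, hψ⟩ := hΛ.2.1 c hc d hd cd
  have hne : ({a, b} : Finset PP) ≠ {c, d} := by
    intro h
    have : a ∈ ({c, d} : Finset PP) := by rw [← h]; simp
    simp at this
    tauto
  obtain ⟨x, hx, -⟩ := hΛ.2.2.2.1 a ha b hb c hc d hd ab cd hne φ ψ hφ hψ
  obtain ⟨y, hy⟩ : ∃ y, y = φ x := ⟨_, rfl⟩
  have h1 : a x y = b x y := (hφ.2 _ _).2 hy
  have h2 : c x y = d x y := (hψ.2 _ _).2 (hy.trans hx)
  obtain ⟨o1, o2, s1, s2, s3, s4⟩ := hX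
  have n1 : a x y ≠ c x y := fun h =>
    hΛ.2.2.2.2.1 a ha b hb c hc d hd ab ac ad bc bd cd ⟨x, y, h1, h, h.trans h2⟩
  have n2 : a x y - p x y ≠ 0 := by
    intro h
    have := o1 x y (by linarith) (by linarith)
    rw [← h2] at this
    nlinarith
  have n3 : c x y - p x y ≠ 0 := by
    intro h
    have := o2 x y (by linarith) (by linarith)
    rw [← h1] at this
    nlinarith
  by_cases c1 : (p x y - a x y) * (c x y - a x y) < 0
  · left
    exact half hΛ hp ha hb hc hd pa pb pc pd ab ac ad bc bd o1 x y h1 h2 c1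
  by_cases c2 : (p x y - c x y) * (a x y - c x y) < 0
  · right
    exact half hΛ hp hc hd ha hb pc pd pa pb cd ac.symm bc.symm ad.symm bd.symm o2 x y h2 h1 c2
  exfalso
  obtain ⟨A, hA⟩ : ∃ A, A = a x y - p x y := ⟨_, rfl⟩
  obtain ⟨C, hC⟩ : ∃ C, C = c x y - p x y := ⟨_, rfl⟩
  have hAC : A * C < 0 := by
    rw [← hA] at n2
    rw [← hC] at n3
    have k1 : ¬ (-A) * (C - A) < 0 := by rw [hA, hC]; convert c1 using 2; ring
    have k2 : ¬ (-C) * (A - C) < 0 := by rw [hA, hC]; convert c2 using 2; ring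
    have k3 : A - C ≠ 0 := by rw [hA, hC]; intro h; apply n1; linarith
    push Not at k1 k2
    by_contra k4
    push Not at k4
    have k5 : 0 < A * C := lt_of_le_of_ne k4 (mul_ne_zero n2 n3).symm
    have k6 : 0 < (A - C) ^ 2 := by positivity
    nlinarith [mul_nonneg k1 k2, mul_pos k5 k6]
  obtain ⟨u, hu, w, hw, huw, x', y', e1, e2, hall⟩ := exclude hΛ hp {a, b, c, d}
    (by intro s; simp only [Finset.mem_insert, Finset.mem_singleton, Finset.mem_erase]; grind)
    (by
      rw [Finset.card_insert_of_notMem (by simp; tauto), Finset.card_insert_of_notMem (by simp; tauto),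
        Finset.card_insert_of_notMem (by simp; tauto)]
      simp)
    (fun s => if s = a ∨ s = b then A else C)
    (by intro s _; split_ifs; exacts [hA ▸ n2, hC ▸ n3]) x y
    (by
      intro s hs
      simp only [Finset.mem_insert, Finset.mem_singleton] at hs
      rcases hs with rfl | rfl | rfl | rfl
      · simp [← hA, mul_self_nonneg]
      · simp [← h1, ← hA, mul_self_nonneg]
      · simp [ac.symm, bc.symm, ← hC, mul_self_nonneg]
      · simp [ad.symm, bd.symm, ← h2, ← hC, mul_self_nonneg])
  have ka := hall a (by simp)
  have kb := hall b (by simp)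
  have kc := hall c (by simp)
  have kd := hall d (by simp)
  simp only [true_or, or_true, if_true] at ka kb
  rw [if_neg (by tauto)] at kc kd
  simp only [Finset.mem_insert, Finset.mem_singleton] at hu hw
  have same : ∀ (A X Y : ℝ), A ≠ 0 → 0 ≤ A * X → 0 ≤ A * Y → ¬ X * Y < 0 := by
    intro A X Y h0 h1 h2 h3
    have := mul_nonneg h1 h2
    have h4 : 0 < A ^ 2 := by positivity
    nlinarith
  have diff : ∀ (X Y : ℝ), 0 ≤ A * X → 0 ≤ C * Y → ¬ 0 < X * Y := by
    intro X Y h1 h2 h3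
    have := mul_nonneg h1 h2
    nlinarith
  have hA0 : A ≠ 0 := hA ▸ n2
  have hC0 : C ≠ 0 := hC ▸ n3
  have f1 := same C _ _ hC0 kc kd
  have f2 := same A _ _ hA0 ka kb
  have g1 := diff _ _ ka kc
  have g2 := diff _ _ ka kd
  have g3 := diff _ _ kb kc
  have g4 := diff _ _ kb kd
  have m1 := o1 x' y'
  have m2 := o2 x' y'
  have m3 := s1 x' y'
  have m4 := s2 x' y'
  have m5 := s3 x' y'
  have m6 := s4 x' y'
  clear hall same diff ka kb kc kd
  rcases hu with rfl | rfl | rfl | rfl <;> rcases hw with rfl | rfl | rfl | rfl <;>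
    first
    | exact absurd rfl huw
    | exact f1 (m1 e1 e2)
    | exact f1 (m1 e2 e1)
    | exact f2 (m2 e1 e2)
    | exact f2 (m2 e2 e1)
    | exact g4 (m3 e1 e2)
    | exact g4 (m3 e2 e1)
    | exact g3 (m4 e1 e2)
    | exact g3 (m4 e2 e1)
    | exact g2 (m5 e1 e2)
    | exact g2 (m5 e2 e1)
    | exact g1 (m6 e1 e2)
    | exact g1 (m6 e2 e1)

theorem sgn_iff {a b : ℝ} (ha : a ≠ 0) (hb : b ≠ 0) : (0 < a ↔ 0 < b) ↔ 0 < a * b := by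
  rw [mul_pos_iff]
  rcases lt_or_gt_of_ne ha with h | h <;> rcases lt_or_gt_of_ne hb with h' | h' <;>
    simp [h, h', h.le, h'.le, not_lt.2]

theorem sgn_sum {a a' b b' c c' : ℝ} (ha : a ≠ 0) (ha' : a' ≠ 0) (hb : b ≠ 0) (hb' : b' ≠ 0)
    (hc : c ≠ 0) (hc' : c' ≠ 0) (h : a * a' - b * b' + c * c' = 0) :
    ¬ ((0 < a ↔ 0 < a') ∧ ¬ (0 < b ↔ 0 < b') ∧ (0 < c ↔ 0 < c')) ∧
    ¬ (¬ (0 < a ↔ 0 < a') ∧ (0 < b ↔ 0 < b') ∧ ¬ (0 < c ↔ 0 < c')) := by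
  rw [sgn_iff ha ha', sgn_iff hb hb', sgn_iff hc hc']
  constructor
  · rintro ⟨h1, h2, h3⟩
    linarith
  · rintro ⟨h1, h2, h3⟩
    linarith

theorem SC_sign {f : ℝ → ℝ} {z X : ℝ} (h : SC f z) (hX : z < X) (x : ℝ) :
    (0 < f x ↔ 0 < f X * (x - z)) ∧ f X ≠ 0 := by
  rcases h with h | h
  · have h1 := (h X).1.2 hX
    refine ⟨?_, h1.ne'⟩
    rw [(h x).1, mul_pos_iff_of_pos_left h1, sub_pos]
  · have h1 := (h X).2.2 hX
    refine ⟨?_, h1.ne⟩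
    rw [(h x).1, aux_pos_neg h1, sub_neg]

theorem chiro_of {ι : Type} (φ : ι → ℝ → ℝ) (t : ι → ℝ) (xx : ι → ι → ℝ) (X : ℝ)
    (ht : ∀ a, t a ≠ 0) (hSC : ∀ a b, a ≠ b → SC (fun x => φ a x - φ b x) (xx a b))
    (hX : ∀ a b, a ≠ b → xx a b < X)
    (hgen : ∀ a b c x, a ≠ b → a ≠ c → b ≠ c → φ a x = φ b x → φ a x ≠ φ c x) :
    ∃ R : ι → ι → Prop, ∃ L : ι → ι → ι → Prop, Chiro R L ∧
      ∀ a b c x, a ≠ b → a ≠ c → b ≠ c → φ a x = φ b x →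
        ((R a b ↔ L a b c) ↔ 0 < t c * (φ a x - φ c x)) := by
  have hr : ∀ a b, a ≠ b → φ a X - φ b X ≠ 0 := fun a b h =>
    (SC_sign (hSC a b h) (hX a b h) 0).2
  have hs : ∀ a b x, a ≠ b → (0 < φ a x - φ b x ↔ 0 < (φ a X - φ b X) * (x - xx a b)) :=
    fun a b x h => (SC_sign (hSC a b h) (hX a b h) x).1
  have hz : ∀ a b x, a ≠ b → (φ a x = φ b x ↔ x = xx a b) := by
    intro a b x h
    rw [← (hSC a b h).zero x, sub_eq_zero]
  have hsym : ∀ a b, a ≠ b → xx a b = xx b a := by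
    intro a b h
    exact (hz b a _ h.symm).1 ((hz a b _ h).2 rfl).symm
  have hxne : ∀ a b c, a ≠ b → a ≠ c → b ≠ c → xx a b - xx a c ≠ 0 := by
    intro a b c h1 h2 h3 h
    exact hgen a b c (xx a b) h1 h2 h3 ((hz a b _ h1).2 rfl) ((hz a c _ h2).2 (by linarith))
  let τ : ι → ι → ℝ := fun a b => t a * t b * (φ a X - φ b X)
  let ℓ : ι → ι → ι → ℝ := fun a b c =>
    t a * t b * t c * (φ a X - φ b X) * (φ a X - φ c X) * (xx a b - xx a c)
  have τ0 : ∀ a b, a ≠ b → τ a b ≠ 0 := fun a b h =>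
    mul_ne_zero (mul_ne_zero (ht a) (ht b)) (hr a b h)
  have ℓ0 : ∀ a b c, a ≠ b → a ≠ c → b ≠ c → ℓ a b c ≠ 0 := fun a b c h1 h2 h3 =>
    mul_ne_zero (mul_ne_zero (mul_ne_zero (mul_ne_zero (mul_ne_zero (ht a) (ht b)) (ht c))
      (hr a b h1)) (hr a c h2)) (hxne a b c h1 h2 h3)
  have anti : ∀ u v : ℝ, u ≠ 0 → v ≠ 0 → u * v < 0 → (0 < u ↔ ¬ 0 < v) := by
    intro u v hu hv h
    have := sgn_iff hu hv
    have h2 : ¬ 0 < u * v := by linarith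
    tauto
  refine ⟨fun a b => 0 < τ a b, fun a b c => 0 < ℓ a b c, ⟨?_, ?_, ?_, ?_, ?_, ?_⟩, ?_⟩
  · intro a b h
    apply anti _ _ (τ0 a b h) (τ0 b a h.symm)
    have : τ a b * τ b a = - (τ a b) ^ 2 := by simp only [τ]; ring
    rw [this]
    have := τ0 a b h
    have : 0 < (τ a b) ^ 2 := by positivity
    linarith
  · intro a; simp [τ]
  · intro a b c h1 h2 h3
    apply anti _ _ (ℓ0 a b c h1 h2 h3) (ℓ0 b a c h1.symm h3 h2)
    have e := (hz a b _ h1).2 rfl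
    have k1 := hs a c (xx a b) h2
    have k2 := hs b c (xx a b) h3
    rw [← e] at k2
    have k3 : 0 < ((φ a X - φ c X) * (xx a b - xx a c)) * ((φ b X - φ c X) * (xx a b - xx b c)) := by
      rw [← sgn_iff]
      · rw [← k1, ← k2]
      · exact mul_ne_zero (hr a c h2) (hxne a b c h1 h2 h3)
      · apply mul_ne_zero (hr b c h3)
        rw [hsym a b h1]
        exact hxne b a c h1.symm h3 h2
    have k4 : ℓ a b c * ℓ b a c = - ((t a * t b * t c * (φ a X - φ b X)) ^ 2 *
        (((φ a X - φ c X) * (xx a b - xx a c)) * ((φ b X - φ c X) * (xx a b - xx b c)))) := by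
      simp only [ℓ]; rw [hsym b a h1.symm]; ring
    rw [k4]
    have k5 : t a * t b * t c * (φ a X - φ b X) ≠ 0 :=
      mul_ne_zero (mul_ne_zero (mul_ne_zero (ht a) (ht b)) (ht c)) (hr a b h1)
    have k6 : 0 < (t a * t b * t c * (φ a X - φ b X)) ^ 2 := by positivity
    have := mul_pos k6 k3
    linarith
  · intro a b c h1 h2 h3
    apply anti _ _ (ℓ0 a b c h1 h2 h3) (ℓ0 a c b h2 h1 h3.symm)
    have : ℓ a b c * ℓ a c b = - (ℓ a b c) ^ 2 := by simp only [ℓ]; ring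
    rw [this]
    have := ℓ0 a b c h1 h2 h3
    have : 0 < (ℓ a b c) ^ 2 := by positivity
    linarith
  · intro a w x y h1 h2 h3 h4 h5 h6
    apply sgn_sum (ℓ0 a w x h1 h2 h4) (τ0 a y h3) (ℓ0 a w y h1 h3 h5) (τ0 a x h2) (τ0 a w h1)
      (ℓ0 a x y h2 h3 h6)
    simp only [ℓ, τ]; ring
  · intro w x y z h1 h2 h3 h4 h5 h6
    apply sgn_sum (τ0 w x h1) (τ0 y z h6) (τ0 w y h2) (τ0 x z h5) (τ0 w z h3) (τ0 x y h4)
    simp only [τ]; ring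
  · intro a b c x h1 h2 h3 hx
    rw [sgn_iff (τ0 a b h1) (ℓ0 a b c h1 h2 h3)]
    have ex := (hz a b x h1).1 hx
    have k0 : t a * t b * (φ a X - φ b X) ≠ 0 := τ0 a b h1
    have k1 : τ a b * ℓ a b c = (t a * t b * (φ a X - φ b X)) ^ 2 *
        (t c * ((φ a X - φ c X) * (x - xx a c))) := by
      simp only [ℓ, τ]; rw [ex]; ring
    have k2 : 0 < (t a * t b * (φ a X - φ b X)) ^ 2 := by positivity
    rw [k1, mul_pos_iff_of_pos_left k2]
    have k3 := hs a c x h2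
    have k4 : φ a x - φ c x ≠ 0 := sub_ne_zero.2 (hgen a b c x h1 h2 h3 hx)
    have k5 : (φ a X - φ c X) * (x - xx a c) ≠ 0 := by
      rw [ex]; exact mul_ne_zero (hr a c h2) (hxne a b c h1 h2 h3)
    rw [← sgn_iff (ht c) k5, ← sgn_iff (ht c) k4, k3]

theorem exists_chiro {Λ : Finset PP} (hΛ : PseudoplaneFamily Λ) {p : PP} (hp : p ∈ Λ) :
    ∃ R : {a // a ∈ Λ.erase p} → {a // a ∈ Λ.erase p} → Prop,
    ∃ L : {a // a ∈ Λ.erase p} → {a // a ∈ Λ.erase p} → {a // a ∈ Λ.erase p} → Prop,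
      Chiro R L ∧ ∀ a b c : {a // a ∈ Λ.erase p}, a ≠ b → a ≠ c → b ≠ c → ∀ x y,
        a.1 x y = p x y → b.1 x y = p x y →
          c.1 x y ≠ p x y ∧ (p x y < c.1 x y ↔ (R a b ↔ L a b c)) := by
  have hm : ∀ a : {a // a ∈ Λ.erase p}, a.1 ≠ p ∧ a.1 ∈ Λ := fun a => Finset.mem_erase.1 a.2
  have hφ : ∀ a : {a // a ∈ Λ.erase p}, ∃ φ : ℝ → ℝ, IsGraphFun p a.1 φ := fun a =>
    hΛ.2.1 p hp a.1 (hm a).2 (hm a).1.symm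
  choose φ hφ using hφ
  have ht : ∀ a : {a // a ∈ Λ.erase p}, ∃ t : ℝ, t ≠ 0 ∧ ∀ x y,
      (p x y < a.1 x y ↔ 0 < t * (y - φ a x)) ∧ (a.1 x y < p x y ↔ t * (y - φ a x) < 0) :=
    fun a => plane_side a.1 p (φ a) (hΛ.1 a.1 (hm a).2) (hΛ.1 p hp) (hφ a)
      (hΛ.2.2.2.2.2.1 a.1 (hm a).2 p hp (hm a).1).1
      (hΛ.2.2.2.2.2.1 a.1 (hm a).2 p hp (hm a).1).2
  choose t ht0 ht using ht
  have hxx : ∀ a b : {a // a ∈ Λ.erase p}, ∃ z : ℝ, a ≠ b → SC (fun x => φ a x - φ b x) z := by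
    intro a b
    by_cases hab : a = b
    · exact ⟨0, fun h => absurd hab h⟩
    have hab' : a.1 ≠ b.1 := fun h => hab (Subtype.ext h)
    obtain ⟨z, hz⟩ := curveSC hΛ hp (hm a).2 (hm b).2 (hm a).1.symm (hm b).1.symm hab' (hφ a)
    refine ⟨z, fun _ => ?_⟩
    have h1 : SC (fun x => t b * (φ a x - φ b x)) z := by
      unfold SC at hz ⊢
      simpa only [sub_pos, sub_neg, ht] using hz
    have h2 := h1.mul (t b)⁻¹ (inv_ne_zero (ht0 b))
    simpa only [inv_mul_cancel_left₀ (ht0 b)] using h2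
  choose xx hxx using hxx
  obtain ⟨X, hX⟩ : ∃ X, ∀ a b, xx a b < X := by
    obtain ⟨M, hM⟩ := (Set.finite_range (fun q : {a // a ∈ Λ.erase p} × {a // a ∈ Λ.erase p} =>
      xx q.1 q.2)).bddAbove
    exact ⟨M + 1, fun a b => by linarith [hM (Set.mem_range_self (a, b))]⟩
  have hne : ∀ a b : {a // a ∈ Λ.erase p}, a ≠ b → a.1 ≠ b.1 := fun a b h h' => h (Subtype.ext h')
  have gen : ∀ a b c : {a // a ∈ Λ.erase p}, a ≠ b → a ≠ c → b ≠ c → ∀ x y,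
      a.1 x y = p x y → b.1 x y = p x y → c.1 x y ≠ p x y := by
    intro a b c h1 h2 h3 x y ha hb hc
    exact hΛ.2.2.2.2.1 p hp a.1 (hm a).2 b.1 (hm b).2 c.1 (hm c).2 (hm a).1.symm (hm b).1.symm
      (hm c).1.symm (hne _ _ h1) (hne _ _ h2) (hne _ _ h3) ⟨x, y, ha.symm, hb.symm, hc.symm⟩
  obtain ⟨R, L, hRL, hs⟩ := chiro_of φ t xx X ht0 hxx (fun a b _ => hX a b) (by
    intro a b c x h1 h2 h3 h4 h5
    exact gen a b c h1 h2 h3 x (φ a x) (((hφ a).2 _ _).2 rfl).symm (((hφ b).2 _ _).2 h4).symm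
      (((hφ c).2 _ _).2 h5).symm)
  refine ⟨R, L, hRL, fun a b c h1 h2 h3 x y ha hb => ⟨gen a b c h1 h2 h3 x y ha hb, ?_⟩⟩
  have ea := ((hφ a).2 _ _).1 ha.symm
  have eb := ((hφ b).2 _ _).1 hb.symm
  rw [hs a b c x h1 h2 h3 (ea.symm.trans eb), (ht c x y).1, ea]

theorem sign_opp {p c d : ℝ} (hc : c ≠ p) (hd : d ≠ p) (h : p < c ↔ ¬ p < d) :
    (c - p) * (d - p) < 0 := by
  rcases lt_or_gt_of_ne hc with h1 | h1 <;> rcases lt_or_gt_of_ne hd with h2 | h2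
  · exact absurd (h.2 h2.not_gt) h1.not_gt
  · exact mul_neg_of_neg_of_pos (by linarith) (by linarith)
  · exact mul_neg_of_pos_of_neg (by linarith) (by linarith)
  · exact absurd h2 (h.1 h1)

theorem sign_sam {p c d : ℝ} (hc : c ≠ p) (hd : d ≠ p) (h : p < c ↔ p < d) :
    0 < (c - p) * (d - p) := by
  rcases lt_or_gt_of_ne hc with h1 | h1 <;> rcases lt_or_gt_of_ne hd with h2 | h2
  · exact mul_pos_of_neg_of_neg (by linarith) (by linarith)
  · exact absurd (h.2 h2) h1.not_gt
  · exact absurd (h.1 h1) h2.not_gt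
  · exact mul_pos (by linarith) (by linarith)

theorem crs_crossing {Λ : Finset PP} {p : PP}
    {R : {a // a ∈ Λ.erase p} → {a // a ∈ Λ.erase p} → Prop}
    {L : {a // a ∈ Λ.erase p} → {a // a ∈ Λ.erase p} → {a // a ∈ Λ.erase p} → Prop}
    (h : Chiro R L) (hs : ∀ a b c : {a // a ∈ Λ.erase p}, a ≠ b → a ≠ c → b ≠ c → ∀ x y,
        a.1 x y = p x y → b.1 x y = p x y →
          c.1 x y ≠ p x y ∧ (p x y < c.1 x y ↔ (R a b ↔ L a b c)))
    (a b c d : {a // a ∈ Λ.erase p}) (ab : a ≠ b) (ac : a ≠ c) (ad : a ≠ d) (bc : b ≠ c)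
    (bd : b ≠ d) (cd : c ≠ d) (hc : Crs L a b c d) : Crossing p a.1 b.1 c.1 d.1 := by
  obtain ⟨k1, k2, k3⟩ := hc
  have r1 := h.rot a b c ab ac bc
  have r2 := h.rot a b d ab ad bd
  have r3 := h.rot a c d ac ad cd
  have r4 := h.rot b c d bc bd cd
  have oppi : ∀ u v w z : {a // a ∈ Λ.erase p}, u ≠ v → u ≠ w → u ≠ z → v ≠ w → v ≠ z →
      (L u v w ↔ ¬ L u v z) → Opp p u.1 v.1 w.1 z.1 := by
    intro u v w z h1 h2 h3 h4 h5 h6 x y e1 e2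
    have q1 := hs u v w h1 h2 h4 x y e1 e2
    have q2 := hs u v z h1 h3 h5 x y e1 e2
    exact sign_opp q1.1 q2.1 (by rw [q1.2, q2.2, h6]; clear * -; tauto)
  have sami : ∀ u v w z : {a // a ∈ Λ.erase p}, u ≠ v → u ≠ w → u ≠ z → v ≠ w → v ≠ z →
      (L u v w ↔ L u v z) → Sam p u.1 v.1 w.1 z.1 := by
    intro u v w z h1 h2 h3 h4 h5 h6 x y e1 e2
    have q1 := hs u v w h1 h2 h4 x y e1 e2
    have q2 := hs u v z h1 h3 h5 x y e1 e2
    exact sign_sam q1.1 q2.1 (by rw [q1.2, q2.2, h6])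
  refine ⟨oppi a b c d ab ac ad bc bd ?_, oppi c d a b cd ac.symm bc.symm ad.symm bd.symm ?_,
    sami a c b d ac ab ad bc.symm cd ?_, sami a d b c ad ab ac bd.symm cd.symm ?_,
    sami b c a d bc ab.symm bd ac.symm cd ?_, sami b d a c bd ab.symm bc ad.symm cd.symm ?_⟩
  all_goals (clear oppi sami hs h; grind)

theorem per_plane {Λ : Finset PP} (hΛ : PseudoplaneFamily Λ) {p : PP} (hp : p ∈ Λ) (k t : ℕ) :
    t ^ 2 * ((kCorridors Λ k).filter fun s => p ∈ s).card ≤ 4 * Λ.card * t ^ 3 +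
      (((kCorridors Λ k ×ˢ kCorridors Λ k).filter fun q => Immersed q.1 q.2).filter
        fun q => q.1 ∩ q.2 = {p}).card := by
  obtain ⟨R, L, h, hs⟩ := exists_chiro hΛ hp
  have hm : ∀ a : {a // a ∈ Λ.erase p}, a.1 ≠ p ∧ a.1 ∈ Λ := fun a => Finset.mem_erase.1 a.2
  have hne : ∀ a b : {a // a ∈ Λ.erase p}, a ≠ b → a.1 ≠ b.1 := fun a b h h' => h (Subtype.ext h')
  obtain ⟨T, hT⟩ : ∃ T : {a // a ∈ Λ.erase p} × {a // a ∈ Λ.erase p} → Finset PP,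
    ∀ e, T e = {p, e.1.1, e.2.1} := ⟨_, fun _ => rfl⟩
  have hTinj : ∀ e f, R e.1 e.2 → R f.1 f.2 → T e = T f → e = f := by
    rintro ⟨a, b⟩ ⟨c, d⟩ h1 h2 h3
    have n1 := h.ne h1
    simp only [hT] at h3
    have m1 : a.1 ∈ ({p, c.1, d.1} : Finset PP) := by rw [← h3]; simp
    have m2 : b.1 ∈ ({p, c.1, d.1} : Finset PP) := by rw [← h3]; simp
    simp only [Finset.mem_insert, Finset.mem_singleton, (hm a).1, (hm b).1, false_or,
      ← Subtype.ext_iff] at m1 m2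
    rcases m1 with rfl | rfl <;> rcases m2 with rfl | rfl
    · exact absurd rfl n1
    · rfl
    · exact absurd h2 (h.asymm h1)
    · exact absurd rfl n1
  obtain ⟨E, hE⟩ : ∃ E : Finset ({a // a ∈ Λ.erase p} × {a // a ∈ Λ.erase p}),
      ∀ e, e ∈ E ↔ R e.1 e.2 ∧ T e ∈ kCorridors Λ k :=
    ⟨Finset.univ.filter fun e => R e.1 e.2 ∧ T e ∈ kCorridors Λ k, by simp⟩
  obtain ⟨Y, hY⟩ : ∃ Y : Finset (({a // a ∈ Λ.erase p} × {a // a ∈ Λ.erase p}) ×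
      ({a // a ∈ Λ.erase p} × {a // a ∈ Λ.erase p})),
      ∀ q, q ∈ Y ↔ q.1 ∈ E ∧ q.2 ∈ E ∧ (q.1.1 ≠ q.2.1 ∧ q.1.1 ≠ q.2.2 ∧ q.1.2 ≠ q.2.1 ∧
        q.1.2 ≠ q.2.2) ∧ Immersed (T q.1) (T q.2) :=
    ⟨Finset.univ.filter fun q => q.1 ∈ E ∧ q.2 ∈ E ∧ (q.1.1 ≠ q.2.1 ∧ q.1.1 ≠ q.2.2 ∧
      q.1.2 ≠ q.2.1 ∧ q.1.2 ≠ q.2.2) ∧ Immersed (T q.1) (T q.2), by simp⟩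
  have main := sampling E Y (fun e he => h.ne ((hE e).1 he).1)
    (fun q hq => by have := (hY q).1 hq; tauto)
    (by
      intro S E' hE' hS hno
      refine linear_bound h S E' hS (fun e he => ((hE e).1 (hE' he)).1) ?_
      intro a b c d hab hcd ac ad bc bd hcrs
      have ab := h.ne ((hE _).1 (hE' hab)).1
      have cd := h.ne ((hE _).1 (hE' hcd)).1
      have hX := crs_crossing h hs a b c d ab ac ad bc bd cd hcrs
      rcases immersion hΛ hp (hm a).2 (hm b).2 (hm c).2 (hm d).2 (hm a).1.symm (hm b).1.symm
        (hm c).1.symm (hm d).1.symm (hne _ _ ab) (hne _ _ ac) (hne _ _ ad) (hne _ _ bc)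
        (hne _ _ bd) (hne _ _ cd) hX with hi | hi
      · refine hno _ hab _ hcd ((hY _).2 ⟨hE' hab, hE' hcd, ⟨ac, ad, bc, bd⟩, ?_⟩)
        rw [hT, hT]; exact hi
      · refine hno _ hcd _ hab ((hY _).2 ⟨hE' hcd, hE' hab, ⟨ac.symm, bc.symm, ad.symm,
          bd.symm⟩, ?_⟩)
        rw [hT, hT]; exact hi) t
  have c1 : ((kCorridors Λ k).filter fun s => p ∈ s).card ≤ E.card := by
    refine le_trans (Finset.card_le_card (t := E.image T) ?_) Finset.card_image_le
    intro s hs'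
    obtain ⟨hs1, hps⟩ := Finset.mem_filter.1 hs'
    have hs2 := Finset.mem_powersetCard.1 (Finset.mem_filter.1 hs1).1
    have hc2 : (s.erase p).card = 2 := by rw [Finset.card_erase_of_mem hps, hs2.2]
    obtain ⟨a, b, hab, he⟩ := Finset.card_eq_two.1 hc2
    have ha : a ∈ Λ.erase p := Finset.erase_subset_erase p hs2.1 (by rw [he]; simp)
    have hb : b ∈ Λ.erase p := Finset.erase_subset_erase p hs2.1 (by rw [he]; simp)
    have es : s = {p, a, b} := by rw [← Finset.insert_erase hps, he]
    have hab' : (⟨a, ha⟩ : {a // a ∈ Λ.erase p}) ≠ ⟨b, hb⟩ := fun h => hab (congrArg Subtype.val h)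
    rw [Finset.mem_image]
    by_cases hr : R ⟨a, ha⟩ ⟨b, hb⟩
    · have et : T (⟨a, ha⟩, ⟨b, hb⟩) = s := by rw [hT, es]
      exact ⟨(⟨a, ha⟩, ⟨b, hb⟩), (hE _).2 ⟨hr, by rw [et]; exact hs1⟩, et⟩
    · have et : T (⟨b, hb⟩, ⟨a, ha⟩) = s := by rw [hT, es, Finset.pair_comm]
      exact ⟨(⟨b, hb⟩, ⟨a, ha⟩), (hE _).2 ⟨(h.hR _ _ hab'.symm).2 hr, by rw [et]; exact hs1⟩, et⟩
  have c2 : Y.card ≤ (((kCorridors Λ k ×ˢ kCorridors Λ k).filter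
      fun q => Immersed q.1 q.2).filter fun q => q.1 ∩ q.2 = {p}).card := by
    apply Finset.card_le_card_of_injOn (fun q => (T q.1, T q.2))
    · intro q hq
      obtain ⟨q1, q2, ⟨n1, n2, n3, n4⟩, q3⟩ := (hY q).1 hq
      refine Finset.mem_filter.2 ⟨Finset.mem_filter.2 ⟨Finset.mem_product.2
        ⟨((hE _).1 q1).2, ((hE _).1 q2).2⟩, q3⟩, ?_⟩
      simp only [hT]
      have := hne _ _ n1
      have := hne _ _ n2
      have := hne _ _ n3
      have := hne _ _ n4
      ext s; simp only [Finset.mem_inter, Finset.mem_insert, Finset.mem_singleton]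
      grind
    · intro q hq q' hq' heq
      obtain ⟨q1, q2, -, -⟩ := (hY q).1 hq
      obtain ⟨q1', q2', -, -⟩ := (hY q').1 hq'
      have := (Prod.mk.injEq _ _ _ _).mp heq
      exact Prod.ext (hTinj _ _ ((hE _).1 q1).1 ((hE _).1 q1').1 this.1)
        (hTinj _ _ ((hE _).1 q2).1 ((hE _).1 q2').1 this.2)
  have c3 : Fintype.card {a // a ∈ Λ.erase p} ≤ Λ.card := by
    rw [Fintype.card_coe]
    exact Finset.card_le_card (Finset.erase_subset _ _)
  calc t ^ 2 * ((kCorridors Λ k).filter fun s => p ∈ s).card ≤ t ^ 2 * E.card := by gcongr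
    _ ≤ 4 * Fintype.card {a // a ∈ Λ.erase p} * t ^ 3 + Y.card := main
    _ ≤ _ := by gcongr

theorem total {Λ : Finset PP} (hΛ : PseudoplaneFamily Λ) (k t : ℕ) :
    t ^ 2 * (3 * (kCorridors Λ k).card) ≤ 4 * Λ.card ^ 2 * t ^ 3 + numImmersedPairs Λ k := by
  have h1 : ∑ p ∈ Λ, ((kCorridors Λ k).filter fun s => p ∈ s).card =
      3 * (kCorridors Λ k).card := by
    simp only [Finset.card_filter]
    rw [Finset.sum_comm, mul_comm, ← smul_eq_mul, ← Finset.sum_const]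
    apply Finset.sum_congr rfl
    intro s hs
    have hs2 := Finset.mem_powersetCard.1 (Finset.mem_filter.1 hs).1
    rw [← Finset.card_filter, ← hs2.2]
    congr 1
    ext a
    rw [Finset.mem_filter]
    exact ⟨fun h => h.2, fun h => ⟨hs2.1 h, h⟩⟩
  have h2 : ∑ p ∈ Λ, (((kCorridors Λ k ×ˢ kCorridors Λ k).filter
      fun q => Immersed q.1 q.2).filter fun q => q.1 ∩ q.2 = {p}).card ≤
      numImmersedPairs Λ k := by
    unfold numImmersedPairs
    rw [← Finset.card_biUnion]
    · apply Finset.card_le_card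
      intro q hq
      obtain ⟨p, -, hq⟩ := Finset.mem_biUnion.1 hq
      exact (Finset.mem_filter.1 hq).1
    · intro p _ p' _ hpp
      rw [Function.onFun, Finset.disjoint_left]
      intro q hq hq'
      apply hpp
      have e1 := (Finset.mem_filter.1 hq).2
      have e2 := (Finset.mem_filter.1 hq').2
      exact Finset.singleton_injective (e1.symm.trans e2)
  have h3 := Finset.sum_le_sum fun p (hp : p ∈ Λ) => per_plane hΛ hp k t
  rw [← Finset.mul_sum, Finset.sum_add_distrib, h1, Finset.sum_const, smul_eq_mul] at h3
  calc _ ≤ _ := h3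
    _ ≤ Λ.card * (4 * Λ.card * t ^ 3) + numImmersedPairs Λ k := by gcongr
    _ = _ := by ring

theorem real_bound (N C X : ℝ) (hN : 0 < N) (hC : 0 ≤ C)
    (h : ∀ t : ℕ, (t : ℝ) ^ 2 * (3 * C) ≤ 4 * N ^ 2 * (t : ℝ) ^ 3 + X) :
    C ^ 3 / (64 * N ^ 4) - N ^ 2 ≤ X := by
  obtain ⟨v, hv⟩ : ∃ v, v = C / (4 * N ^ 2) := ⟨_, rfl⟩
  have hv0 : 0 ≤ v := by rw [hv]; positivity
  have hCv : C = 4 * N ^ 2 * v := by rw [hv]; field_simp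
  have h1 := h ⌊v⌋₊
  have h2 := Nat.floor_le hv0
  have h3 := Nat.lt_floor_add_one v
  have h4 : C ^ 3 / (64 * N ^ 4) = N ^ 2 * v ^ 3 := by rw [hCv]; field_simp; ring
  rw [h4]
  have hN2 : 0 < N ^ 2 := by positivity
  obtain ⟨m, hm⟩ : ∃ m : ℕ, m = ⌊v⌋₊ := ⟨_, rfl⟩
  rw [← hm] at h1 h2 h3
  have key : v ^ 3 - 1 ≤ 12 * (m : ℝ) ^ 2 * v - 4 * (m : ℝ) ^ 3 := by
    rcases Nat.eq_zero_or_pos m with h0 | h0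
    · rw [h0] at h3 ⊢
      simp at h3 ⊢
      exact pow_le_one₀ hv0 h3.le
    · have h5 : (1 : ℝ) ≤ m := by exact_mod_cast h0
      obtain ⟨w, hw⟩ : ∃ w, w = v - m := ⟨_, rfl⟩
      have : v = m + w := by linarith
      rw [this]
      have w0 : 0 ≤ w := by linarith
      have w1 : w ≤ 1 := by linarith
      have hm0 : (0 : ℝ) ≤ m := by linarith
      have i1 : w ^ 3 ≤ 1 := pow_le_one₀ w0 w1
      have i2 : (m : ℝ) * w ^ 2 ≤ (m : ℝ) ^ 2 * w := by
        have : (m : ℝ) * w * w ≤ (m : ℝ) * w * m := by gcongr; linarith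
        nlinarith
      have i3 : 0 ≤ (m : ℝ) ^ 2 * w := by positivity
      have i4 : 0 ≤ (m : ℝ) ^ 3 := by positivity
      nlinarith
  rw [hCv] at h1
  have := mul_le_mul_of_nonneg_left key hN2.le
  nlinarith

/-- For a family `Λ` of `n` pseudoplanes in general position in ℝ³ and a
nonnegative integer `k`, the number `X^k` of ordered pairs of immersed `k`-corridors
satisfies `X^k ≥ |C^k|³ / (64 n⁴) − n²`. -/
theorem statement2 (Λ : Finset PP) (n k : ℕ) (hn : Λ.card = n)
    (hΛ : PseudoplaneFamily Λ) :
    (numImmersedPairs Λ k : ℝ) ≥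
      ((kCorridors Λ k).card : ℝ) ^ 3 / (64 * (n : ℝ) ^ 4) - (n : ℝ) ^ 2 := by
  rcases Nat.eq_zero_or_pos n with h0 | h0
  · subst h0
    simp
  · refine real_bound n _ _ (by exact_mod_cast h0) (by positivity) ?_
    intro t
    have := total hΛ k t
    rw [hn] at this
    exact_mod_cast this
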